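/- arXiv:1504.01719 — 2 statements merged into one kernel-verified Lean document; each statement's English description precedes it below -/
import Mathlib

section
/- For all a ∈ P_m and b ∈ P_n, the following two subsets of P_{m+n} are equal: A(a,b) = { ãΘb̃ : ã ∈ P_m, b̃ ∈ P_n, a ≤_* ã, b ≤_* b̃, Θ ∈ R(ã, b̃) } and B(a,b) = { c ∈ P_{m+n} : a|b ≤_* c }. -/
open scoped Classical

/-- Words on natural numbers (letters are intended to be positive integers). -/
abbrev W : Type := List ℕ

/-- `IsPF a` : the word `a` is a parking function, i.e. all its letters are
positive and its nondecreasing rearrangement `b₁ b₂ ⋯ bₙ` satisfies `bᵢ ≤ i`. -/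
def IsPF (a : W) : Prop :=
  (∀ x ∈ a, 1 ≤ x) ∧
    ∀ i, i < a.length → (a.insertionSort (· ≤ ·)).getD i 0 ≤ i + 1

/-- Split a word into the consecutive segments beginning at its
left-to-right minima (in the order in which they occur in the word). -/
def segs : W → List W
  | [] => []
  | x :: xs =>
      (x :: xs.takeWhile fun y => x ≤ y) :: segs (xs.dropWhile fun y => x ≤ y)
termination_by a => a.length
decreasing_by
  simpa using Nat.lt_succ_of_le (List.dropWhile_sublist _).length_le

/-- The LR-decomposition `F_a` of a word `a`: the sequence of segments beginning
at the left-to-right minima, listed in increasing order of their minimal letters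
(i.e. in reverse order of occurrence in `a`). -/
def LR (a : W) : List W := (segs a).reverse

/-- The word `w_k ⋯ w_2 w_1` encoded by an LR-decomposition `(w_1, …, w_k)`. -/
def wordOf (F : List W) : W := F.reverse.flatten

/-- A word is dominated if it is nonempty and its first letter is its minimal letter. -/
def Dominated (w : W) : Prop := w ≠ [] ∧ ∀ x ∈ w, w.headD 0 ≤ x

/-- The minimal letter of a word (`0` for the empty word). -/
def minW (w : W) : ℕ := (w.min?).getD 0

/-- Add `m` to every letter of a word. -/
def shiftW (m : ℕ) (w : W) : W := w.map (· + m)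

/-- Add `m` to every letter of every word of a sequence of words. -/
def shiftF (m : ℕ) (F : List W) : List W := F.map (shiftW m)

/-- The word whose LR-decomposition is the finite set of words `G`:
sort `G` increasingly (for dominated words with distinct minimal letters the
lexicographic order agrees with comparing the minimal letters) and concatenate
in decreasing order. -/
noncomputable def wordOfSet (G : Finset W) : W := (G.sort (· ≤ ·)).reverse.flatten

/-- Given vertex sets `X`, `Y` (of words) and a set `Θ` of edges, the resulting
set of words: concatenations `u ++ w` over edges `(u, w) ∈ Θ`, together with all
unmatched words of `X` and of `Y`. -/
noncomputable def glueSet (X Y : Finset W) (Θ : Finset (W × W)) : Finset W :=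
  Θ.image (fun p => p.1 ++ p.2) ∪
    X.filter (fun u => ∀ p ∈ Θ, p.1 ≠ u) ∪
    Y.filter (fun w => ∀ p ∈ Θ, p.2 ≠ w)

/-- `R(a,b)` : the set of matchings between `F_a` and `F_b + m` (`m` the length
of `a`), encoded as sets of edges in which no vertex occurs twice. -/
noncomputable def Rset (a b : W) : Finset (Finset (W × W)) :=
  ((LR a).toFinset ×ˢ (shiftF a.length (LR b)).toFinset).powerset.filter
    (fun Θ => ∀ p ∈ Θ, ∀ q ∈ Θ, (p.1 = q.1 ∨ p.2 = q.2) → p = q)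

/-- `aΘb` : the parking function whose LR-decomposition consists of the
concatenations `u ⬝ (w + m)` over the edges `(u, w + m)` of `Θ` together with all
unmatched words of `F_a` and of `F_b + m`. -/
noncomputable def mTheta (a b : W) (Θ : Finset (W × W)) : W :=
  wordOfSet (glueSet (LR a).toFinset (shiftF a.length (LR b)).toFinset Θ)

/-- `d(a) = min { i : #{ j : a_j ≤ i } < i }`. -/
def dVal (a : W) : ℕ :=
  Nat.find (p := fun i => (a.filter (fun x => x ≤ i)).length < i)
    ⟨a.length + 1, Nat.lt_succ_of_le (List.length_filter_le _ _)⟩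

/-- One step of the parkization algorithm: decrement every letter greater
than `d(a)`.  (This is the identity when `a` is a parking function.) -/
def parkStep (a : W) : W := a.map fun x => if dVal a < x then x - 1 else x

/-- Auxiliary fueled version of the parkization algorithm. -/
def parkFuel : ℕ → W → W
  | 0, a => a
  | k + 1, a => if dVal a = a.length + 1 then a else parkFuel k (parkStep a)

/-- The parkization `Park a` of a word `a`.  (For a word with positive letters
the algorithm needs at most `a.sum` steps, so the fuel below suffices.) -/
def Park (a : W) : W := parkFuel a.sum a

/-- The subword of `a` obtained by keeping exactly the words of `F_a`
belonging to `S`. -/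
def subWord (a : W) (S : Finset W) : W := wordOf ((LR a).filter (· ∈ S))

/-- The free module with basis indexed by words; the Hopf algebra `PFSym` is
its submodule spanned by `{M_a : a ∈ P}`. -/
abbrev FW (K : Type) [Field K] : Type := W →₀ K

/-- The monomial basis element `M_a`. -/
noncomputable def Mb (K : Type) [Field K] (a : W) : FW K := Finsupp.single a 1

/-- `M_a ⋆ M_b = Σ_{Θ ∈ R(a,b)} M_{aΘb}` on basis elements. -/
noncomputable def mulSingle (K : Type) [Field K] (a b : W) : FW K :=
  ∑ Θ ∈ Rset a b, Mb K (mTheta a b Θ)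

/-- The product `⋆`, extended bilinearly. -/
noncomputable def starF (K : Type) [Field K] (x y : FW K) : FW K :=
  x.sum fun a ca => y.sum fun b cb => (ca * cb) • mulSingle K a b

/-- The free module with basis indexed by pairs of words; it realizes the
tensor square of `FW K` via `M_a ⊗ M_b ↦ single (a,b)`. -/
abbrev FW2 (K : Type) [Field K] : Type := (W × W) →₀ K

/-- `Δ(M_a) = Σ M_{Park a'} ⊗ M_{Park a''}` over ordered pairs `(a', a'')` of
subwords of `a` with `F_{a'} ⊍ F_{a''} = F_a` (encoded by the subset
`S ⊆ F_a` of words kept in `a'`). -/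
noncomputable def deltaSingle (K : Type) [Field K] (a : W) : FW2 K :=
  ∑ S ∈ ((LR a).toFinset).powerset,
    Finsupp.single
      (Park (subWord a S), Park (subWord a (((LR a).toFinset) \ S))) 1

/-- The coproduct `Δ`, extended linearly. -/
noncomputable def deltaF (K : Type) [Field K] (x : FW K) : FW2 K :=
  x.sum fun a ca => ca • deltaSingle K a

/-- The componentwise product on the tensor square, on basis elements:
`(M_a ⊗ M_b) ⋆ (M_c ⊗ M_d) = (M_a ⋆ M_c) ⊗ (M_b ⋆ M_d)`. -/
noncomputable def star2Single (K : Type) [Field K] (p q : W × W) : FW2 K :=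
  ∑ Θ ∈ Rset p.1 q.1, ∑ Θ' ∈ Rset p.2 q.2,
    Finsupp.single (mTheta p.1 q.1 Θ, mTheta p.2 q.2 Θ') 1

/-- The componentwise product on the tensor square, extended bilinearly. -/
noncomputable def star2F (K : Type) [Field K] (x y : FW2 K) : FW2 K :=
  x.sum fun p cp => y.sum fun q cq => (cp * cq) • star2Single K p q

/-- The counit `ε` on basis elements. -/
noncomputable def epsW (K : Type) [Field K] (a : W) : K := if a = [] then 1 else 0

/-- `F_a ∘ F_b` : concatenate the `i`-th words of `F_a` and `F_b + m`
for `i ≤ min(r,s)` and keep the remaining unpaired words. -/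
def splitLR (F G : List W) : List W :=
  List.zipWith (· ++ ·) F G ++ F.drop G.length ++ G.drop F.length

/-- The split product `a ∘ b`. -/
def splitProd (a b : W) : W := wordOf (splitLR (LR a) (shiftF a.length (LR b)))

/-- A nonempty parking function is unsplitable if it is not the split product
of two nonempty parking functions. -/
def UnsplitablePF (a : W) : Prop :=
  IsPF a ∧ a ≠ [] ∧
    ¬ ∃ b c : W, IsPF b ∧ IsPF c ∧ b ≠ [] ∧ c ≠ [] ∧ a = splitProd b c

/-- The slash product `a | b = (b₁+m) ⋯ (bₙ+m) a₁ ⋯ a_m`. -/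
def slashProd (a b : W) : W := shiftW a.length b ++ a

/-- A nonempty parking function is atomic if it is not the slash product
of two nonempty parking functions. -/
def AtomicPF (a : W) : Prop :=
  IsPF a ∧ a ≠ [] ∧
    ¬ ∃ b c : W, IsPF b ∧ IsPF c ∧ b ≠ [] ∧ c ≠ [] ∧ a = slashProd b c

/-- `u ≺* v` : either `v` is a proper initial subword of `u`, or `u` is not a
proper initial subword of `v` and `u` precedes `v` lexicographically. -/
def precStar (u v : W) : Prop :=
  (v <+: u ∧ v ≠ u) ∨ (¬ (u <+: v ∧ u ≠ v) ∧ List.Lex (· < ·) u v)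

/-- `a ≺*_lex b` : `F_a` strictly precedes `F_b` in the lexicographic order
on sequences of words induced by `≺*`. -/
def precStarLex (a b : W) : Prop := List.Lex precStar (LR a) (LR b)

/-- The covering relation of `≤_*` : `b` covers `a` if `F_b` is obtained from
`F_a = (w_1, …, w_r)` by replacing `w_i` by `w_i ⬝ w_j` and removing `w_j`,
for some `i < j` such that every letter of `w_i` is at most every letter of `w_j`. -/
def CovStar (a b : W) : Prop :=
  ∃ i j, i < j ∧ j < (LR a).length ∧
    (∀ x ∈ (LR a).getD i [], ∀ y ∈ (LR a).getD j [], x ≤ y) ∧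
    LR b = ((LR a).set i ((LR a).getD i [] ++ (LR a).getD j [])).eraseIdx j

/-- The partial order `≤_*` on parking functions, generated by the covering
relations. -/
def leStar (a b : W) : Prop := Relation.ReflTransGen CovStar a b

/-- The finite set of all parking functions of length `n`. -/
noncomputable def pfFinset (n : ℕ) : Finset W :=
  ((Finset.univ : Finset (Fin n → Fin n)).image
      (fun f => List.ofFn fun i => (f i).val + 1)).filter IsPF

/-- The basis element `Q_a = Σ_{a ≤_* b} M_b`. -/
noncomputable def Qb (K : Type) [Field K] (a : W) : FW K :=
  ∑ b ∈ (pfFinset a.length).filter (fun b => leStar a b), Mb K b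

/-- `Q_x ⊗ Q_y` as an element of the tensor square. -/
noncomputable def QT (K : Type) [Field K] (x y : W) : FW2 K :=
  ∑ b ∈ (pfFinset x.length).filter (fun b => leStar x b),
    ∑ c ∈ (pfFinset y.length).filter (fun c => leStar y c),
      Finsupp.single (b, c) 1

/-- `a` is a nonincreasing word. -/
def NonInc (a : W) : Prop := a.Chain' (fun x y => y ≤ x)

/-- Every word of the LR-decomposition of `a` is nondecreasing. -/
def Nprop (a : W) : Prop := ∀ w ∈ LR a, w.Chain' (· ≤ ·)

/-- The words of the LR-decomposition of `a` have pairwise disjoint sets of letters. -/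
def Dprop (a : W) : Prop := (LR a).Pairwise (fun u v => ∀ x ∈ u, x ∉ v)

/-- `a` is a permutation of `{1, …, n}` viewed as a word. -/
def Sprop (a : W) : Prop := a.Perm (List.range' 1 a.length)


/-! ### Valid lists of words -/

/-- First letter. -/
def hd (w : W) : ℕ := w.headD 0

/-- A list is an LR-decomposition. -/
def VL (L : List W) : Prop := (∀ w ∈ L, Dominated w) ∧ (L.map hd).Pairwise (· < ·)

/-- A finite set of words underlies an LR-decomposition. -/
def VS (S : Finset W) : Prop := (∀ w ∈ S, Dominated w) ∧ ∀ u ∈ S, ∀ v ∈ S, hd u = hd v → u = v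

theorem hd_append {u v : W} (h : u ≠ []) : hd (u ++ v) = hd u := by
  cases u <;> simp_all [hd]

theorem hd_mem {u : W} (h : u ≠ []) : hd u ∈ u := by
  cases u <;> simp_all [hd]

theorem segs_nil : segs [] = [] := by rw [segs]

theorem segs_cons (x : ℕ) (xs : W) : segs (x :: xs) =
    (x :: xs.takeWhile fun y => x ≤ y) :: segs (xs.dropWhile fun y => x ≤ y) := by
  rw [segs]

theorem segs_flatten (a : W) : (segs a).flatten = a := by
  induction h : a.length using Nat.strong_induction_on generalizing a with
  | _ n ih =>
    cases a with
    | nil => simp [segs_nil]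
    | cons x xs =>
      rw [segs_cons, List.flatten_cons, ih _ _ _ rfl]
      · simp
      · subst h
        simpa using Nat.lt_succ_of_le (List.dropWhile_sublist _).length_le

theorem dropWhile_lt (x : ℕ) (xs : W) (y : ℕ) (ys : W)
    (h : xs.dropWhile (fun y => x ≤ y) = y :: ys) : y < x := by
  have := List.head_dropWhile_not (fun y => decide (x ≤ y)) (l := xs) (by rw [h]; simp)
  simpa [h] using this

theorem segs_spec (a : W) : (∀ w ∈ segs a, Dominated w) ∧
    ((segs a).map hd).Pairwise (· > ·) ∧ ∀ w ∈ segs a, hd w ≤ hd a := by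
  induction h : a.length using Nat.strong_induction_on generalizing a with
  | _ n ih =>
    cases a with
    | nil => simp [segs_nil]
    | cons x xs =>
      have := ih _ (by
        subst h
        simpa using Nat.lt_succ_of_le (List.dropWhile_sublist (fun y => decide (x ≤ y))).length_le) (xs.dropWhile fun y => x ≤ y) rfl
      obtain ⟨h1, h2, h3⟩ := this
      have key : ∀ w ∈ segs (xs.dropWhile fun y => x ≤ y), hd w < x := by
        intro w hw
        rcases hc : xs.dropWhile (fun y => decide (x ≤ y)) with _ | ⟨y, ys⟩
        · rw [hc, segs_nil] at hw; simp at hw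
        · have := dropWhile_lt _ _ _ _ hc
          have := h3 w hw
          rw [hc] at this
          simp only [hd, List.headD_cons] at this ⊢
          omega
      rw [segs_cons]
      refine ⟨?_, ?_, ?_⟩
      · intro w hw
        rcases List.mem_cons.1 hw with rfl | hw
        · refine ⟨by simp, ?_⟩
          intro y hy
          rcases List.mem_cons.1 hy with rfl | hy
          · simp
          · simpa using List.mem_takeWhile_imp hy
        · exact h1 w hw
      · rw [List.map_cons, List.pairwise_cons]
        refine ⟨?_, h2⟩
        intro y hy
        obtain ⟨w, hw, rfl⟩ := List.mem_map.1 hy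
        exact key w hw
      · intro w hw
        rcases List.mem_cons.1 hw with rfl | hw
        · simp [hd]
        · exact (key w hw).le

theorem VL_LR (a : W) : VL (LR a) := by
  obtain ⟨h1, h2, -⟩ := segs_spec a
  refine ⟨by simpa [LR] using h1, ?_⟩
  rw [LR, List.map_reverse, List.pairwise_reverse]
  exact h2

theorem wordOf_LR (a : W) : wordOf (LR a) = a := by
  simp [wordOf, LR, segs_flatten]

theorem segs_append (x : ℕ) (w r : W) (hw : ∀ y ∈ w, x ≤ y) (hr : ∀ y ∈ r.head?, y < x) :
    segs (x :: (w ++ r)) = (x :: w) :: segs r := by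
  rw [segs_cons]
  have e1 : (w ++ r).takeWhile (fun y => decide (x ≤ y)) = w := by
    rw [List.takeWhile_append_of_pos (by simpa using hw)]
    cases r with
    | nil => simp
    | cons z r => simp at hr; simp [hr]
  have e2 : (w ++ r).dropWhile (fun y => decide (x ≤ y)) = r := by
    rw [List.dropWhile_append_of_pos (by simpa using hw)]
    cases r with
    | nil => simp
    | cons z r => simp at hr; simp [hr]
  rw [e1, e2]

theorem segs_of_valid (L : List W) (h1 : ∀ w ∈ L, Dominated w)
    (h2 : (L.map hd).Pairwise (· > ·)) : segs L.flatten = L := by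
  induction L with
  | nil => simp [segs_nil]
  | cons w L ih =>
    rw [List.map_cons, List.pairwise_cons] at h2
    obtain ⟨hne, hdom⟩ := h1 w (by simp)
    cases w with
    | nil => simp at hne
    | cons x w =>
      rw [List.flatten_cons, List.cons_append, segs_append, ih (fun w hw => h1 w (by simp [hw])) h2.2]
      · intro y hy
        exact hdom y (by simp [hy])
      · intro y hy
        cases L with
        | nil => simp at hy
        | cons w' L =>
          have h3 := (h1 w' (by simp)).1
          have h4 := h2.1 (hd w') (by simp)
          cases w' with
          | nil => simp at h3
          | cons z w' =>
            simp [hd] at h4 hy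
            omega

theorem LR_wordOf {L : List W} (h : VL L) : LR (wordOf L) = L := by
  rw [LR, wordOf, segs_of_valid]
  · simp
  · simpa using h.1
  · rw [List.map_reverse, List.pairwise_reverse]
    exact h.2

theorem VL.nodup {L : List W} (h : VL L) : L.Nodup :=
  List.Nodup.of_map hd (h.2.imp (fun h => Nat.ne_of_lt h))

theorem VL.ext {L M : List W} (hL : VL L) (hM : VL M) (h : L.toFinset = M.toFinset) : L = M := by
  have hp : L.Perm M := (List.perm_ext_iff_of_nodup hL.nodup hM.nodup).2 (fun w => by
    rw [← List.mem_toFinset, h, List.mem_toFinset])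
  refine List.Perm.eq_of_pairwise (le := fun u v => hd u < hd v) ?_ ?_ ?_ hp
  · intro a b _ _ h1 h2; omega
  · exact List.pairwise_map.1 hL.2
  · exact List.pairwise_map.1 hM.2

theorem VL.toVS {L : List W} (h : VL L) : VS L.toFinset := by
  refine ⟨by simpa using h.1, ?_⟩
  intro u hu v hv e
  rw [List.mem_toFinset] at hu hv
  have : (L.map hd).Nodup := h.2.imp (fun h => Nat.ne_of_lt h)
  exact List.inj_on_of_nodup_map this hu hv e

theorem VS.sortVL {S : Finset W} (h : VS S) : VL (S.sort (· ≤ ·)) := by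
  refine ⟨by simpa using h.1, ?_⟩
  rw [List.pairwise_map]
  have h1 := S.pairwise_sort (· ≤ ·)
  have h2 : (S.sort (· ≤ ·)).Pairwise (· ≠ ·) := S.sort_nodup (· ≤ ·)
  refine ((h1.and h2).imp_of_mem ?_)
  intro u v hu hv ⟨hle, hne⟩
  rw [Finset.mem_sort] at hu hv
  have hd1 : hd u ≠ hd v := fun e => hne (h.2 u hu v hv e)
  have hu0 := (h.1 u hu).1
  have hv0 := (h.1 v hv).1
  have hlt : u < v := lt_of_le_of_ne hle hne
  cases u with
  | nil => simp at hu0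
  | cons x u =>
    cases v with
    | nil => simp at hv0
    | cons y v =>
      simp only [hd, List.headD_cons] at hd1 ⊢
      rw [List.cons_lt_cons_iff] at hlt
      rcases hlt with h | h
      · exact h
      · exact absurd h.1 hd1

/-- The set of words of the LR-decomposition. -/
noncomputable def GS (a : W) : Finset W := (LR a).toFinset

theorem VS_GS (a : W) : VS (GS a) := (VL_LR a).toVS

theorem LR_wordOfSet {S : Finset W} (h : VS S) : LR (wordOfSet S) = S.sort (· ≤ ·) :=
  LR_wordOf h.sortVL

theorem GS_wordOfSet {S : Finset W} (h : VS S) : GS (wordOfSet S) = S := by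
  rw [GS, LR_wordOfSet h, Finset.sort_toFinset]

theorem wordOfSet_GS (a : W) : wordOfSet (GS a) = a := by
  have h := VS_GS a
  have : (GS a).sort (· ≤ ·) = LR a := h.sortVL.ext (VL_LR a) (by
    rw [Finset.sort_toFinset, GS])
  rw [wordOfSet, this]
  exact wordOf_LR a

theorem GS_inj {a b : W} (h : GS a = GS b) : a = b := by
  rw [← wordOfSet_GS a, h, wordOfSet_GS]

theorem sum_GS (a : W) : ∑ w ∈ GS a, (w : Multiset ℕ) = (a : Multiset ℕ) := by
  rw [GS, List.sum_toFinset _ (VL_LR a).nodup]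
  conv_rhs => rw [← wordOf_LR a, wordOf]
  generalize LR a = L
  induction L with
  | nil => simp
  | cons w L ih => simp [← ih, add_comm, ← Multiset.coe_add]

/-! ### Steps on sets of words -/

/-- The covering relation on finite sets of words. -/
def Step (S T : Finset W) : Prop :=
  ∃ u ∈ S, ∃ v ∈ S, u ≠ v ∧ (∀ x ∈ u, ∀ y ∈ v, x ≤ y) ∧
    T = insert (u ++ v) ((S.erase u).erase v)

theorem mem_merge {S : Finset W} {u v w : W} :
    w ∈ insert (u ++ v) ((S.erase u).erase v) ↔ w = u ++ v ∨ (w ∈ S ∧ w ≠ u ∧ w ≠ v) := by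
  simp only [Finset.mem_insert, Finset.mem_erase]; tauto

theorem merge_dom {u v : W} (hu : Dominated u) (hv : Dominated v)
    (h : ∀ x ∈ u, ∀ y ∈ v, x ≤ y) : Dominated (u ++ v) := by
  refine ⟨by simp [hu.1], ?_⟩
  have e : (u ++ v).headD 0 = u.headD 0 := hd_append hu.1
  intro x hx
  rw [e]
  rcases List.mem_append.1 hx with hx | hx
  · exact hu.2 x hx
  · exact h _ (hd_mem hu.1) _ hx

theorem Step.VS {S T : Finset W} (h : Step S T) (hS : VS S) : VS T := by
  obtain ⟨u, hu, v, hv, hne, hle, rfl⟩ := h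
  have hh : hd (u ++ v) = hd u := hd_append (hS.1 u hu).1
  constructor
  · intro w hw
    rcases mem_merge.1 hw with rfl | hw
    · exact merge_dom (hS.1 u hu) (hS.1 v hv) hle
    · exact hS.1 w hw.1
  · intro w hw w' hw' e
    rcases mem_merge.1 hw with rfl | hw <;> rcases mem_merge.1 hw' with rfl | hw'
    · rfl
    · exact absurd (hS.2 _ hw'.1 _ hu (by rw [← e, hh])) hw'.2.1
    · exact absurd (hS.2 _ hw.1 _ hu (by rw [e, hh])) hw.2.1
    · exact hS.2 _ hw.1 _ hw'.1 e

theorem append_notMem {S : Finset W} (hS : VS S) {u v : W} (hu : u ∈ S) (hv : v ∈ S) :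
    u ++ v ∉ S := by
  intro h
  have := hS.2 _ h _ hu (hd_append (hS.1 u hu).1)
  simp at this
  exact (hS.1 v hv).1 this

theorem Step.sum {S T : Finset W} (h : Step S T) (hS : _root_.VS S) :
    ∑ w ∈ T, (w : Multiset ℕ) = ∑ w ∈ S, (w : Multiset ℕ) := by
  obtain ⟨u, hu, v, hv, hne, hle, rfl⟩ := h
  rw [Finset.sum_insert (by simp [append_notMem hS hu hv]),
    ← Finset.add_sum_erase S _ hu, ← Finset.add_sum_erase (S.erase u) _ (a := v) (by simp [hv, hne.symm]),
    ← add_assoc, ← Multiset.coe_add]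

theorem surgery_toFinset {L : List W} (hL : L.Nodup) {i j : ℕ} (hij : i < j) (hj : j < L.length)
    (w : W) :
    ((L.set i w).eraseIdx j).toFinset =
      insert w ((L.toFinset.erase (L.getD i [])).erase (L.getD j [])) := by
  have hi : i < L.length := by omega
  ext z
  rw [List.mem_toFinset, List.mem_eraseIdx_iff_getElem, Finset.mem_insert, Finset.mem_erase,
    Finset.mem_erase, List.mem_toFinset]
  rw [List.getD_eq_getElem _ _ hi, List.getD_eq_getElem _ _ hj]
  constructor
  · rintro ⟨k, hk, hkj, rfl⟩
    simp only [List.length_set] at hk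
    rw [List.getElem_set]
    split_ifs with h
    · simp
    · refine Or.inr ⟨?_, ?_, List.getElem_mem _⟩
      · rw [Ne, hL.getElem_inj_iff]; exact hkj
      · rw [Ne, hL.getElem_inj_iff]; omega
  · rintro (rfl | ⟨h1, h2, h3⟩)
    · exact ⟨i, by simpa using hi, by omega, by simp⟩
    · obtain ⟨k, hk, rfl⟩ := List.getElem_of_mem h3
      rw [Ne, hL.getElem_inj_iff] at h1 h2
      exact ⟨k, by simpa using hk, by omega, by rw [List.getElem_set]; simp [Ne.symm h2]⟩

theorem CovStar.step {a b : W} (h : CovStar a b) : Step (GS a) (GS b) := by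
  obtain ⟨i, j, hij, hj, hle, e⟩ := h
  have hi : i < (LR a).length := by omega
  have hnd := (VL_LR a).nodup
  refine ⟨(LR a).getD i [], ?_, (LR a).getD j [], ?_, ?_, hle, ?_⟩
  · rw [List.getD_eq_getElem _ _ hi, GS, List.mem_toFinset]; exact List.getElem_mem _
  · rw [List.getD_eq_getElem _ _ hj, GS, List.mem_toFinset]; exact List.getElem_mem _
  · rw [List.getD_eq_getElem _ _ hi, List.getD_eq_getElem _ _ hj, Ne, hnd.getElem_inj_iff]; omega
  · rw [GS, e, surgery_toFinset hnd hij hj, GS]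

theorem Step.covStar {a b : W} (h : Step (GS a) (GS b)) : CovStar a b := by
  obtain ⟨u, hu, v, hv, hne, hle, e⟩ := h
  have hVL := VL_LR a
  rw [GS, List.mem_toFinset] at hu hv
  have hdlt : hd u < hd v := by
    have h1 : hd u ≤ hd v := hle _ (hd_mem (hVL.1 u hu).1) _ (hd_mem (hVL.1 v hv).1)
    have h2 : hd u ≠ hd v := fun e => hne (hVL.toVS.2 u (by simpa using hu) v (by simpa using hv) e)
    omega
  have hune := (hVL.1 u hu).1
  have hdom := merge_dom (hVL.1 u hu) (hVL.1 v hv) hle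
  obtain ⟨i, hi, rfl⟩ := List.getElem_of_mem hu
  obtain ⟨j, hj, rfl⟩ := List.getElem_of_mem hv
  have hij : i < j := by
    by_contra hc
    have hne' : i ≠ j := fun e => hne (by subst e; rfl)
    have := List.pairwise_iff_getElem.1 hVL.2 j i (by simpa using hj) (by simpa using hi) (by omega)
    simp at this
    omega
  refine ⟨i, j, hij, hj, ?_, ?_⟩
  · rw [List.getD_eq_getElem _ _ hi, List.getD_eq_getElem _ _ hj]; exact hle
  · apply (VL_LR b).ext
    · refine ⟨?_, ?_⟩
      · intro w hw
        have hw := List.mem_of_mem_eraseIdx hw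
        rcases List.mem_or_eq_of_mem_set hw with hw | hw
        · exact hVL.1 w hw
        · rw [List.getD_eq_getElem _ _ hi, List.getD_eq_getElem _ _ hj] at hw
          rw [hw]; exact hdom
      · refine List.Pairwise.sublist ((List.eraseIdx_sublist _ _).map hd) ?_
        rw [List.map_set, List.getD_eq_getElem _ _ hi, hd_append hune]
        have : ((LR a).map hd).set i (hd (LR a)[i]) = (LR a).map hd := by
          apply List.ext_getElem
          · simp
          · intro k h1 h2
            rw [List.getElem_set]
            split_ifs with h
            · subst h; simp
            · rfl
        rw [this]
        exact hVL.2
    · rw [surgery_toFinset hVL.nodup hij hj, List.getD_eq_getElem _ _ hi, List.getD_eq_getElem _ _ hj]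
      exact e

open Relation in
theorem leStar.steps {a b : W} (h : leStar a b) : ReflTransGen Step (GS a) (GS b) := by
  exact ReflTransGen.lift (p := Step) GS (fun _ _ h => CovStar.step h) _ _ h

open Relation in
theorem steps_VS {S T : Finset W} (h : ReflTransGen Step S T) (hS : VS S) : VS T := by
  induction h with
  | refl => exact hS
  | tail _ h ih => exact h.VS ih

open Relation in
theorem steps_leStar {S T : Finset W} (hS : VS S) (h : ReflTransGen Step S T) :
    leStar (wordOfSet S) (wordOfSet T) := by
  induction h with
  | refl => exact ReflTransGen.refl
  | tail h1 h2 ih =>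
    refine ReflTransGen.tail ih (Step.covStar ?_)
    have := steps_VS h1 hS
    rw [GS_wordOfSet this, GS_wordOfSet (h2.VS this)]
    exact h2

theorem leStar.perm {a b : W} (h : leStar a b) : b.Perm a := by
  induction h with
  | refl => exact List.Perm.refl _
  | tail _ h ih =>
    refine List.Perm.trans ?_ ih
    rw [← Multiset.coe_eq_coe, ← sum_GS, ← sum_GS]
    exact h.step.sum (VS_GS _)

/-! ### Letters separated by a predicate -/

/-- All words nonempty with letters satisfying `P`. -/
def AllP (P : ℕ → Prop) (S : Finset W) : Prop := ∀ w ∈ S, w ≠ [] ∧ ∀ x ∈ w, P x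

theorem Step.allP {P : ℕ → Prop} {S T : Finset W} (h : Step S T) (hS : AllP P S) : AllP P T := by
  obtain ⟨u, hu, v, hv, hne, hle, rfl⟩ := h
  intro w hw
  rcases mem_merge.1 hw with rfl | hw
  · refine ⟨by simp [(hS u hu).1], ?_⟩
    intro x hx
    rcases List.mem_append.1 hx with hx | hx
    · exact (hS u hu).2 x hx
    · exact (hS v hv).2 x hx
  · exact hS w hw.1

open Relation in
theorem steps_allP {P : ℕ → Prop} {S T : Finset W} (h : ReflTransGen Step S T) (hS : AllP P S) :
    AllP P T := by
  induction h with
  | refl => exact hS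
  | tail _ h ih => exact h.allP ih

theorem allP_disj {m : ℕ} {w : W} (hne : w ≠ []) (h1 : ∀ x ∈ w, x ≤ m) (h2 : ∀ x ∈ w, m < x) :
    False := by
  have := h1 _ (hd_mem hne)
  have := h2 _ (hd_mem hne)
  omega

theorem Step.union {X X' Y : Finset W} (hd : ∀ w ∈ X, w ∉ Y) (h : Step X X') :
    Step (X ∪ Y) (X' ∪ Y) := by
  obtain ⟨u, hu, v, hv, hne, hle, rfl⟩ := h
  refine ⟨u, by simp [hu], v, by simp [hv], hne, hle, ?_⟩
  have := hd u hu
  have := hd v hv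
  ext w
  simp only [Finset.mem_union, mem_merge]
  grind

open Relation in
theorem steps_union_left {m : ℕ} {X X' Y : Finset W} (hX : AllP (· ≤ m) X) (hY : AllP (m < ·) Y)
    (h : ReflTransGen Step X X') : ReflTransGen Step (X ∪ Y) (X' ∪ Y) := by
  induction h with
  | refl => exact ReflTransGen.refl
  | tail h1 h2 ih =>
    have h3 := steps_allP h1 hX
    exact ih.tail (h2.union fun w hw hw' => allP_disj (h3 w hw).1 (h3 w hw).2 (hY w hw').2)

open Relation in
theorem steps_union_right {m : ℕ} {X Y Y' : Finset W} (hX : AllP (· ≤ m) X) (hY : AllP (m < ·) Y)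
    (h : ReflTransGen Step Y Y') : ReflTransGen Step (X ∪ Y) (X ∪ Y') := by
  induction h with
  | refl => exact ReflTransGen.refl
  | tail h1 h2 ih =>
    have h3 := steps_allP h1 hY
    refine ih.tail ?_
    rw [Finset.union_comm X, Finset.union_comm X]
    exact (h2.union fun w hw hw' => allP_disj (h3 w hw).1 (hX w hw').2 (h3 w hw).2)

theorem mem_glueSet {X Y : Finset W} {Θ : Finset (W × W)} {w : W} :
    w ∈ glueSet X Y Θ ↔ (∃ p ∈ Θ, p.1 ++ p.2 = w) ∨ (w ∈ X ∧ ∀ p ∈ Θ, p.1 ≠ w) ∨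
      (w ∈ Y ∧ ∀ p ∈ Θ, p.2 ≠ w) := by
  simp only [glueSet, Finset.mem_union, Finset.mem_image, Finset.mem_filter, or_assoc]

open Relation in
theorem steps_glue {m : ℕ} {X Y : Finset W} (hX : AllP (· ≤ m) X) (hY : AllP (m < ·) Y)
    (Θ : Finset (W × W)) (h1 : ∀ p ∈ Θ, p.1 ∈ X ∧ p.2 ∈ Y)
    (h2 : ∀ p ∈ Θ, ∀ q ∈ Θ, (p.1 = q.1 ∨ p.2 = q.2) → p = q) :
    ReflTransGen Step (X ∪ Y) (glueSet X Y Θ) := by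
  induction Θ using Finset.induction_on with
  | empty =>
    have : glueSet X Y ∅ = X ∪ Y := by ext w; simp [mem_glueSet]
    rw [this]
  | insert p Θ hp ih =>
    obtain ⟨x, y⟩ := p
    have h1' : ∀ p ∈ Θ, p.1 ∈ X ∧ p.2 ∈ Y := fun p hp => h1 p (by simp [hp])
    refine (ih h1' (fun p hp q hq => h2 p (by simp [hp]) q (by simp [hq]))).tail ?_
    have hx : x ∈ X := (h1 (x, y) (by simp)).1
    have hy : y ∈ Y := (h1 (x, y) (by simp)).2
    have dis : ∀ w ∈ X, w ∉ Y := fun w hw hw' => allP_disj (hX w hw).1 (hX w hw).2 (hY w hw').2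
    have n1 : ∀ q ∈ Θ, q.1 ≠ x := by
      intro q hq e
      have := h2 (x, y) (by simp) q (by simp [hq]) (Or.inl e.symm)
      exact hp (this ▸ hq)
    have n2 : ∀ q ∈ Θ, q.2 ≠ y := by
      intro q hq e
      have := h2 (x, y) (by simp) q (by simp [hq]) (Or.inr e.symm)
      exact hp (this ▸ hq)
    have catX : ∀ q ∈ Θ, q.1 ++ q.2 ∉ X := by
      intro q hq hc
      have h3 := hY _ (h1' q hq).2
      exact allP_disj h3.1 (fun z hz => (hX _ hc).2 z (by simp [hz])) h3.2
    have catY : ∀ q ∈ Θ, q.1 ++ q.2 ∉ Y := by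
      intro q hq hc
      have h3 := hX _ (h1' q hq).1
      exact allP_disj h3.1 h3.2 (fun z hz => (hY _ hc).2 z (by simp [hz]))
    refine ⟨x, mem_glueSet.2 (Or.inr (Or.inl ⟨hx, n1⟩)), y,
      mem_glueSet.2 (Or.inr (Or.inr ⟨hy, n2⟩)), fun e => dis x hx (e ▸ hy), ?_, ?_⟩
    · intro s hs t ht
      have := (hX x hx).2 s hs
      have := (hY y hy).2 t ht
      simp only at *
      omega
    · ext w
      simp only [mem_glueSet, mem_merge, Finset.exists_mem_insert, Finset.forall_mem_insert]
      constructor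
      · rintro ((h | ⟨q, hq, rfl⟩) | ⟨hw, h3, h4⟩ | ⟨hw, h3, h4⟩)
        · exact Or.inl h.symm
        · exact Or.inr ⟨Or.inl ⟨q, hq, rfl⟩, fun e => catX q hq (e ▸ hx), fun e => catY q hq (e ▸ hy)⟩
        · exact Or.inr ⟨Or.inr (Or.inl ⟨hw, h4⟩), h3.symm, fun e => dis w hw (e ▸ hy)⟩
        · exact Or.inr ⟨Or.inr (Or.inr ⟨hw, h4⟩), fun e => dis x hx (e ▸ hw), h3.symm⟩
      · rintro (h | ⟨⟨q, hq, rfl⟩ | ⟨hw, h3⟩ | ⟨hw, h3⟩, h4, h5⟩)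
        · exact Or.inl (Or.inl h.symm)
        · exact Or.inl (Or.inr ⟨q, hq, rfl⟩)
        · exact Or.inr (Or.inl ⟨hw, h4.symm, h3⟩)
        · exact Or.inr (Or.inr ⟨hw, h5.symm, h3⟩)

/-! ### Projections -/

/-- The nonempty restrictions of words of `C` to letters satisfying `p`. -/
def prj (p : ℕ → Bool) (C : Finset W) : Finset W := (C.image (List.filter p)).erase []

theorem mem_prj {p : ℕ → Bool} {C : Finset W} {w : W} :
    w ∈ prj p C ↔ w ≠ [] ∧ ∃ u ∈ C, u.filter p = w := by
  simp [prj]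

/-- The nonempty restrictions have distinct first letters. -/
def HInv (p : ℕ → Bool) (C : Finset W) : Prop :=
  ∀ u ∈ C, ∀ v ∈ C, u.filter p ≠ [] → v.filter p ≠ [] → hd (u.filter p) = hd (v.filter p) → u = v

theorem Step.inv {p : ℕ → Bool} {C D : Finset W} (h : Step C D) (hC : HInv p C) : HInv p D := by
  obtain ⟨u, hu, v, hv, hne, hle, rfl⟩ := h
  have key : ∀ w ∈ C, w ≠ u → w ≠ v → w.filter p ≠ [] → (u ++ v).filter p ≠ [] →
      hd (w.filter p) ≠ hd ((u ++ v).filter p) := by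
    intro w hw h1 h2 h3 h4 e
    rw [List.filter_append] at e h4
    by_cases h5 : u.filter p = []
    · rw [h5, List.nil_append] at e h4
      exact h2 (hC w hw v hv h3 h4 e)
    · rw [hd_append h5] at e
      exact h1 (hC w hw u hu h3 h5 e)
  intro w hw w' hw' h1 h2 e
  rcases mem_merge.1 hw with rfl | hw <;> rcases mem_merge.1 hw' with rfl | hw'
  · rfl
  · exact absurd e.symm (key w' hw'.1 hw'.2.1 hw'.2.2 h2 h1)
  · exact absurd e (key w hw.1 hw.2.1 hw.2.2 h1 h2)
  · exact hC w hw.1 w' hw'.1 h1 h2 e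

theorem Step.prj {p : ℕ → Bool} {C D : Finset W} (h : Step C D) (hC : HInv p C) :
    Step (prj p C) (_root_.prj p D) ∨ _root_.prj p D = _root_.prj p C := by
  obtain ⟨u, hu, v, hv, hne, hle, rfl⟩ := h
  have inj : ∀ w ∈ C, ∀ w' ∈ C, w.filter p ≠ [] → w.filter p = w'.filter p → w = w' :=
    fun w hw w' hw' h1 e => hC w hw w' hw' h1 (e ▸ h1) (by rw [e])
  by_cases h1 : u.filter p = []
  · right
    ext w
    simp only [mem_prj, mem_merge]
    constructor
    · rintro ⟨hw, z, rfl | hz, rfl⟩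
      · exact ⟨hw, v, hv, by simp [List.filter_append, h1]⟩
      · exact ⟨hw, z, hz.1, rfl⟩
    · rintro ⟨hw, z, hz, rfl⟩
      refine ⟨hw, ?_⟩
      by_cases hzv : z = v
      · exact ⟨u ++ v, Or.inl rfl, by simp [List.filter_append, h1, hzv]⟩
      · exact ⟨z, Or.inr ⟨hz, fun e => hw (e ▸ h1), hzv⟩, rfl⟩
  by_cases h2 : v.filter p = []
  · right
    ext w
    simp only [mem_prj, mem_merge]
    constructor
    · rintro ⟨hw, z, rfl | hz, rfl⟩
      · exact ⟨hw, u, hu, by simp [List.filter_append, h2]⟩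
      · exact ⟨hw, z, hz.1, rfl⟩
    · rintro ⟨hw, z, hz, rfl⟩
      refine ⟨hw, ?_⟩
      by_cases hzu : z = u
      · exact ⟨u ++ v, Or.inl rfl, by simp [List.filter_append, h2, hzu]⟩
      · exact ⟨z, Or.inr ⟨hz, hzu, fun e => hw (e ▸ h2)⟩, rfl⟩
  left
  refine ⟨u.filter p, mem_prj.2 ⟨h1, u, hu, rfl⟩, v.filter p, mem_prj.2 ⟨h2, v, hv, rfl⟩,
    fun e => hne (inj u hu v hv h1 e),
    fun x hx y hy => hle x (List.mem_of_mem_filter hx) y (List.mem_of_mem_filter hy), ?_⟩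
  ext w
  simp only [mem_prj, mem_merge]
  constructor
  · rintro ⟨hw, z, rfl | hz, rfl⟩
    · left; rw [List.filter_append]
    · exact Or.inr ⟨⟨hw, z, hz.1, rfl⟩, fun e => hz.2.1 (inj _ hz.1 _ hu hw e),
        fun e => hz.2.2 (inj _ hz.1 _ hv hw e)⟩
  · rintro (rfl | ⟨⟨hw, z, hz, rfl⟩, h3, h4⟩)
    · exact ⟨by simp [h1], u ++ v, Or.inl rfl, List.filter_append ..⟩
    · exact ⟨hw, z, Or.inr ⟨hz, fun e => h3 (by rw [e]), fun e => h4 (by rw [e])⟩, rfl⟩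

open Relation in
theorem steps_prj {p : ℕ → Bool} {C D : Finset W} (h : ReflTransGen Step C D) (hC : HInv p C) :
    HInv p D ∧ ReflTransGen Step (prj p C) (prj p D) := by
  induction h with
  | refl => exact ⟨hC, ReflTransGen.refl⟩
  | tail _ h ih =>
    refine ⟨h.inv ih.1, ?_⟩
    rcases h.prj ih.1 with h | h
    · exact ih.2.tail h
    · rw [h]; exact ih.2

/-- Letters at most `m`. -/
def lo (m : ℕ) : ℕ → Bool := fun x => decide (x ≤ m)
/-- Letters greater than `m`. -/
def hi (m : ℕ) : ℕ → Bool := fun x => decide (m < x)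

/-- Every word is its small part followed by its large part. -/
def Good (m : ℕ) (C : Finset W) : Prop := ∀ w ∈ C, w.filter (lo m) ++ w.filter (hi m) = w

theorem Step.good {m : ℕ} {C D : Finset W} (h : Step C D) (hC : Good m C) : Good m D := by
  obtain ⟨u, hu, v, hv, hne, hle, rfl⟩ := h
  intro w hw
  rcases mem_merge.1 hw with rfl | hw
  · rw [List.filter_append, List.filter_append]
    have h1 := hC u hu
    have h2 := hC v hv
    by_cases h3 : u.filter (hi m) = []
    · rw [h3, List.append_nil] at h1
      rw [h3, h1, List.nil_append, List.append_assoc, h2]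
    · have h4 : v.filter (lo m) = [] := by
        by_contra h4
        have h5 := hd_mem h3
        have h6 := hd_mem h4
        rw [List.mem_filter] at h5 h6
        have := hle _ h5.1 _ h6.1
        have a1 := h5.2
        have a2 := h6.2
        simp only [lo, hi, decide_eq_true_eq] at a1 a2 this
        omega
      rw [h4, List.nil_append] at h2
      rw [h4, h2, List.append_nil, ← List.append_assoc, h1]
  · exact hC w hw.1

open Relation in
theorem steps_good {m : ℕ} {C D : Finset W} (h : ReflTransGen Step C D) (hC : Good m C) :
    Good m D := by
  induction h with
  | refl => exact hC
  | tail _ h ih => exact h.good ih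

/-- The matching read off from a set of words. -/
noncomputable def thetaOf (m : ℕ) (C : Finset W) : Finset (W × W) :=
  (C.filter (fun w => w.filter (lo m) ≠ [] ∧ w.filter (hi m) ≠ [])).image
    (fun w => (w.filter (lo m), w.filter (hi m)))

theorem mem_thetaOf {m : ℕ} {C : Finset W} {q : W × W} : q ∈ thetaOf m C ↔
    ∃ w ∈ C, w.filter (lo m) ≠ [] ∧ w.filter (hi m) ≠ [] ∧
      (w.filter (lo m), w.filter (hi m)) = q := by
  simp only [thetaOf, Finset.mem_image, Finset.mem_filter, and_assoc]

theorem HInv.inj {p : ℕ → Bool} {C : Finset W} (hC : HInv p C) : ∀ w ∈ C, ∀ w' ∈ C,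
    w.filter p ≠ [] → w.filter p = w'.filter p → w = w' :=
  fun w hw w' hw' h1 e => hC w hw w' hw' h1 (e ▸ h1) (by rw [e])

theorem thetaOf_matching {m : ℕ} {C : Finset W} (h1 : HInv (lo m) C) (h2 : HInv (hi m) C) :
    ∀ p ∈ thetaOf m C, ∀ q ∈ thetaOf m C, (p.1 = q.1 ∨ p.2 = q.2) → p = q := by
  intro p hp q hq h
  obtain ⟨u, hu, hu1, hu2, rfl⟩ := mem_thetaOf.1 hp
  obtain ⟨v, hv, hv1, hv2, rfl⟩ := mem_thetaOf.1 hq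
  have : u = v := by
    rcases h with h | h
    · exact h1.inj u hu v hv hu1 h
    · exact h2.inj u hu v hv hu2 h
  rw [this]

theorem thetaOf_sub {m : ℕ} {C : Finset W} :
    ∀ p ∈ thetaOf m C, p.1 ∈ prj (lo m) C ∧ p.2 ∈ prj (hi m) C := by
  intro p hp
  obtain ⟨u, hu, hu1, hu2, rfl⟩ := mem_thetaOf.1 hp
  exact ⟨mem_prj.2 ⟨hu1, u, hu, rfl⟩, mem_prj.2 ⟨hu2, u, hu, rfl⟩⟩

theorem glue_prj {m : ℕ} {C : Finset W} (hne : ∀ w ∈ C, w ≠ []) (hg : Good m C)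
    (h1 : HInv (lo m) C) (h2 : HInv (hi m) C) :
    glueSet (prj (lo m) C) (prj (hi m) C) (thetaOf m C) = C := by
  ext w
  rw [mem_glueSet]
  constructor
  · rintro (⟨q, hq, rfl⟩ | ⟨hw, h⟩ | ⟨hw, h⟩)
    · obtain ⟨u, hu, -, -, rfl⟩ := mem_thetaOf.1 hq
      have := hg u hu
      simp only
      rw [this]; exact hu
    · obtain ⟨hw, u, hu, rfl⟩ := mem_prj.1 hw
      have h3 : u.filter (hi m) = [] := by
        by_contra h3
        exact h _ (mem_thetaOf.2 ⟨u, hu, hw, h3, rfl⟩) rfl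
      have := hg u hu
      rw [h3, List.append_nil] at this
      rw [this]; exact hu
    · obtain ⟨hw, u, hu, rfl⟩ := mem_prj.1 hw
      have h3 : u.filter (lo m) = [] := by
        by_contra h3
        exact h _ (mem_thetaOf.2 ⟨u, hu, h3, hw, rfl⟩) rfl
      have := hg u hu
      rw [h3, List.nil_append] at this
      rw [this]; exact hu
  · intro hw
    have hgw := hg w hw
    by_cases h3 : w.filter (lo m) = []
    · right; right
      rw [h3, List.nil_append] at hgw
      refine ⟨mem_prj.2 ⟨hne w hw, w, hw, hgw⟩, ?_⟩
      intro q hq e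
      obtain ⟨u, hu, hu1, hu2, rfl⟩ := mem_thetaOf.1 hq
      have := h2.inj u hu w hw hu2 (by rw [hgw]; exact e)
      exact hu1 (this ▸ h3)
    by_cases h4 : w.filter (hi m) = []
    · right; left
      rw [h4, List.append_nil] at hgw
      refine ⟨mem_prj.2 ⟨hne w hw, w, hw, hgw⟩, ?_⟩
      intro q hq e
      obtain ⟨u, hu, hu1, hu2, rfl⟩ := mem_thetaOf.1 hq
      have := h1.inj u hu w hw hu1 (by rw [hgw]; exact e)
      exact hu2 (this ▸ h4)
    · left
      exact ⟨_, mem_thetaOf.2 ⟨w, hw, h3, h4, rfl⟩, hgw⟩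

theorem lo_lo {m : ℕ} {w : W} (h : ∀ x ∈ w, x ≤ m) : w.filter (lo m) = w := by
  rw [List.filter_eq_self]; simpa [lo] using h
theorem hi_lo {m : ℕ} {w : W} (h : ∀ x ∈ w, x ≤ m) : w.filter (hi m) = [] := by
  rw [List.filter_eq_nil_iff]; simpa [hi] using h
theorem hi_hi {m : ℕ} {w : W} (h : ∀ x ∈ w, m < x) : w.filter (hi m) = w := by
  rw [List.filter_eq_self]; simpa [hi] using h
theorem lo_hi {m : ℕ} {w : W} (h : ∀ x ∈ w, m < x) : w.filter (lo m) = [] := by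
  rw [List.filter_eq_nil_iff]; simpa [lo] using h

theorem good_union {m : ℕ} {X Y : Finset W} (hX : AllP (· ≤ m) X) (hY : AllP (m < ·) Y) :
    Good m (X ∪ Y) := by
  intro w hw
  rcases Finset.mem_union.1 hw with hw | hw
  · rw [lo_lo (hX w hw).2, hi_lo (hX w hw).2, List.append_nil]
  · rw [lo_hi (hY w hw).2, hi_hi (hY w hw).2, List.nil_append]

theorem prj_lo_union {m : ℕ} {X Y : Finset W} (hX : AllP (· ≤ m) X) (hY : AllP (m < ·) Y) :
    prj (lo m) (X ∪ Y) = X := by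
  ext w
  rw [mem_prj]
  constructor
  · rintro ⟨hw, u, hu, rfl⟩
    rcases Finset.mem_union.1 hu with hu | hu
    · rw [lo_lo (hX u hu).2]; exact hu
    · exact absurd (lo_hi (hY u hu).2) hw
  · intro hw
    exact ⟨(hX w hw).1, w, by simp [hw], lo_lo (hX w hw).2⟩

theorem prj_hi_union {m : ℕ} {X Y : Finset W} (hX : AllP (· ≤ m) X) (hY : AllP (m < ·) Y) :
    prj (hi m) (X ∪ Y) = Y := by
  ext w
  rw [mem_prj]
  constructor
  · rintro ⟨hw, u, hu, rfl⟩
    rcases Finset.mem_union.1 hu with hu | hu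
    · exact absurd (hi_lo (hX u hu).2) hw
    · rw [hi_hi (hY u hu).2]; exact hu
  · intro hw
    exact ⟨(hY w hw).1, w, by simp [hw], hi_hi (hY w hw).2⟩

theorem inv_union {m : ℕ} {X Y : Finset W} (hV : VS (X ∪ Y)) (hX : AllP (· ≤ m) X)
    (hY : AllP (m < ·) Y) : HInv (lo m) (X ∪ Y) ∧ HInv (hi m) (X ∪ Y) := by
  have hg := good_union hX hY
  constructor
  · have : ∀ u ∈ X ∪ Y, u.filter (lo m) ≠ [] → u.filter (lo m) = u := by
      intro u hu h
      rcases Finset.mem_union.1 hu with hu | hu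
      · exact lo_lo (hX u hu).2
      · exact absurd (lo_hi (hY u hu).2) h
    intro u hu v hv h1 h2 e
    rw [this u hu h1, this v hv h2] at e
    exact hV.2 u hu v hv e
  · have : ∀ u ∈ X ∪ Y, u.filter (hi m) ≠ [] → u.filter (hi m) = u := by
      intro u hu h
      rcases Finset.mem_union.1 hu with hu | hu
      · exact absurd (hi_lo (hX u hu).2) h
      · exact hi_hi (hY u hu).2
    intro u hu v hv h1 h2 e
    rw [this u hu h1, this v hv h2] at e
    exact hV.2 u hu v hv e

/-! ### Shifts -/

/-- Shift of a set of words. -/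
def sh (m : ℕ) (S : Finset W) : Finset W := S.image (shiftW m)

theorem shiftW_inj (m : ℕ) : Function.Injective (shiftW m) :=
  List.map_injective_iff.2 (fun x y h => by simpa using h)

theorem shiftW_append (m : ℕ) (u v : W) : shiftW m (u ++ v) = shiftW m u ++ shiftW m v := by
  simp [shiftW]

theorem sh_merge (m : ℕ) (S : Finset W) (u v : W) :
    sh m (insert (u ++ v) ((S.erase u).erase v)) =
      insert (shiftW m u ++ shiftW m v) (((sh m S).erase (shiftW m u)).erase (shiftW m v)) := by
  rw [sh, Finset.image_insert, Finset.image_erase (shiftW_inj m), Finset.image_erase (shiftW_inj m),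
    shiftW_append, sh]

theorem shiftW_le {m : ℕ} {u v : W} : (∀ x ∈ shiftW m u, ∀ y ∈ shiftW m v, x ≤ y) ↔
    ∀ x ∈ u, ∀ y ∈ v, x ≤ y := by
  simp [shiftW]

theorem Step.sh {m : ℕ} {S T : Finset W} (h : Step S T) : Step (sh m S) (_root_.sh m T) := by
  obtain ⟨u, hu, v, hv, hne, hle, rfl⟩ := h
  exact ⟨shiftW m u, Finset.mem_image_of_mem _ hu, shiftW m v, Finset.mem_image_of_mem _ hv,
    fun e => hne (shiftW_inj m e), shiftW_le.2 hle, sh_merge ..⟩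

theorem Step.unsh {m : ℕ} {S T : Finset W} (h : Step (_root_.sh m S) T) :
    ∃ T', Step S T' ∧ T = _root_.sh m T' := by
  obtain ⟨u, hu, v, hv, hne, hle, rfl⟩ := h
  obtain ⟨u, hu', rfl⟩ := Finset.mem_image.1 hu
  obtain ⟨v, hv', rfl⟩ := Finset.mem_image.1 hv
  exact ⟨_, ⟨u, hu', v, hv', fun e => hne (by rw [e]), shiftW_le.1 hle, rfl⟩, (sh_merge ..).symm⟩

open Relation in
theorem steps_sh {m : ℕ} {S T : Finset W} (h : ReflTransGen Step S T) :
    ReflTransGen Step (sh m S) (sh m T) := by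
  induction h with
  | refl => exact ReflTransGen.refl
  | tail _ h ih => exact ih.tail h.sh

open Relation in
theorem steps_unsh {m : ℕ} {S T : Finset W} (h : ReflTransGen Step (sh m S) T) :
    ∃ T', ReflTransGen Step S T' ∧ T = sh m T' := by
  induction h with
  | refl => exact ⟨S, ReflTransGen.refl, rfl⟩
  | tail _ h ih =>
    obtain ⟨T', h1, rfl⟩ := ih
    obtain ⟨T'', h2, rfl⟩ := h.unsh
    exact ⟨T'', h1.tail h2, rfl⟩

theorem shiftF_toFinset (m : ℕ) (b : W) : (shiftF m (LR b)).toFinset = sh m (GS b) := by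
  ext w; simp [shiftF, sh, GS]

theorem mem_of_mem_GS {a w : W} (hw : w ∈ GS a) {x : ℕ} (hx : x ∈ w) : x ∈ a := by
  have h : x ∈ wordOf (LR a) := by
    rw [GS, List.mem_toFinset] at hw
    simp only [wordOf, List.mem_flatten, List.mem_reverse]
    exact ⟨w, hw, hx⟩
  rwa [wordOf_LR] at h

theorem allP_GS {P : ℕ → Prop} {a : W} (h : ∀ x ∈ a, P x) : AllP P (GS a) :=
  fun w hw => ⟨((VS_GS a).1 w hw).1, fun x hx => h x (mem_of_mem_GS hw hx)⟩

theorem allP_sh {m : ℕ} {b : W} (h : ∀ x ∈ b, 1 ≤ x) : AllP (m < ·) (sh m (GS b)) := by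
  intro w hw
  obtain ⟨u, hu, rfl⟩ := Finset.mem_image.1 hw
  refine ⟨by simpa [shiftW] using ((VS_GS b).1 u hu).1, ?_⟩
  intro x hx
  obtain ⟨y, hy, rfl⟩ := List.mem_map.1 hx
  have := h y (mem_of_mem_GS hu hy)
  omega

theorem hd_shiftW {m : ℕ} {w : W} (h : w ≠ []) : hd (shiftW m w) = hd w + m := by
  cases w <;> simp_all [hd, shiftW]

theorem LR_slash {a b : W} (ha : ∀ x ∈ a, x ≤ a.length) (hb : ∀ x ∈ b, 1 ≤ x) :
    LR (slashProd a b) = LR a ++ shiftF a.length (LR b) := by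
  have e : slashProd a b = wordOf (LR a ++ shiftF a.length (LR b)) := by
    have h2 : wordOf (shiftF a.length (LR b)) = shiftW a.length b := by
      conv_rhs => rw [← wordOf_LR b]
      simp only [wordOf, shiftF, shiftW, List.map_flatten, List.map_reverse]
      rfl
    have h1 := wordOf_LR a
    rw [slashProd, ← h2]
    conv_lhs => rw [← h1]
    rw [h1]
    simp [wordOf]
    exact h1.symm
  have hA := allP_GS ha
  have hB := allP_sh (m := a.length) hb
  rw [e]
  apply LR_wordOf
  have hVa := VL_LR a
  have hVb := VL_LR b
  have heads : (shiftF a.length (LR b)).map hd = ((LR b).map hd).map (· + a.length) := by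
    simp only [shiftF, List.map_map]
    apply List.map_congr_left
    intro w hw
    exact hd_shiftW (hVb.1 w hw).1
  refine ⟨?_, ?_⟩
  · intro w hw
    rcases List.mem_append.1 hw with hw | hw
    · exact hVa.1 w hw
    · obtain ⟨u, hu, rfl⟩ := List.mem_map.1 hw
      have hu' := hVb.1 u hu
      refine ⟨by simpa [shiftW] using hu'.1, ?_⟩
      intro x hx
      have h5 : (shiftW a.length u).headD 0 = hd u + a.length := hd_shiftW hu'.1
      rw [h5]
      obtain ⟨y, hy, rfl⟩ := List.mem_map.1 hx
      exact Nat.add_le_add_right (hu'.2 y hy) _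
  · rw [List.map_append, List.pairwise_append]
    refine ⟨hVa.2, ?_, ?_⟩
    · rw [heads, List.pairwise_map]
      exact hVb.2.imp (fun h => Nat.add_lt_add_right h _)
    · intro x hx y hy
      obtain ⟨u, hu, rfl⟩ := List.mem_map.1 hx
      obtain ⟨v, hv, rfl⟩ := List.mem_map.1 hy
      have hu' := hA u (by simpa [GS] using hu)
      have hv' := hB v (by rw [← shiftF_toFinset]; simpa using hv)
      have := hu'.2 _ (hd_mem hu'.1)
      have := hv'.2 _ (hd_mem hv'.1)
      simp only at *
      omega

theorem GS_slash {a b : W} (ha : ∀ x ∈ a, x ≤ a.length) (hb : ∀ x ∈ b, 1 ≤ x) :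
    GS (slashProd a b) = GS a ∪ sh a.length (GS b) := by
  rw [GS, LR_slash ha hb, List.toFinset_append, shiftF_toFinset]
  rfl

/-! ### Parking functions -/

theorem IsPF.perm {a b : W} (h : IsPF a) (hp : b.Perm a) : IsPF b := by
  refine ⟨fun x hx => h.1 x (hp.mem_iff.1 hx), ?_⟩
  have : b.insertionSort (· ≤ ·) = a.insertionSort (· ≤ ·) :=
    List.Perm.eq_of_pairwise' (r := (· ≤ ·)) (List.pairwise_insertionSort _ _)
      (List.pairwise_insertionSort _ _)
      (((List.perm_insertionSort _ _).trans hp).trans (List.perm_insertionSort _ _).symm)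
  rw [this, hp.length_eq]
  exact h.2

theorem IsPF.le_length {a : W} (h : IsPF a) : ∀ x ∈ a, x ≤ a.length := by
  intro x hx
  have : x ∈ a.insertionSort (· ≤ ·) := (List.mem_insertionSort _).2 hx
  obtain ⟨i, hi, rfl⟩ := List.getElem_of_mem this
  have hi' : i < a.length := by simpa using hi
  have := h.2 i hi'
  rw [List.getD_eq_getElem _ _ hi] at this
  omega

theorem IsPF.slash {a b : W} (ha : IsPF a) (hb : IsPF b) : IsPF (slashProd a b) := by
  refine ⟨?_, ?_⟩
  · intro x hx
    rcases List.mem_append.1 hx with hx | hx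
    · obtain ⟨y, hy, rfl⟩ := List.mem_map.1 hx
      have := hb.1 y hy
      omega
    · exact ha.1 x hx
  · have e : (slashProd a b).insertionSort (· ≤ ·) =
        a.insertionSort (· ≤ ·) ++ (b.insertionSort (· ≤ ·)).map (· + a.length) := by
      refine List.Perm.eq_of_pairwise' (r := (· ≤ ·)) (List.pairwise_insertionSort _ _) ?_ ?_
      · rw [List.pairwise_append]
        refine ⟨List.pairwise_insertionSort _ _, ?_, ?_⟩
        · rw [List.pairwise_map]
          exact (List.pairwise_insertionSort (· ≤ ·) b).imp (fun h => Nat.add_le_add_right h _)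
        · intro x hx y hy
          rw [List.mem_insertionSort] at hx
          obtain ⟨z, hz, rfl⟩ := List.mem_map.1 hy
          have := ha.le_length x hx
          omega
      · refine (List.perm_insertionSort _ _).trans ?_
        refine List.perm_append_comm.trans ?_
        exact (List.perm_insertionSort _ _).symm.append ((List.perm_insertionSort _ _).symm.map _)
    intro i hi
    rw [e]
    by_cases h : i < a.length
    · rw [List.getD_append _ _ _ _ (by simpa using h)]
      exact ha.2 i h
    · have hi' : i - a.length < b.length := by
        simp [slashProd, shiftW] at hi; omega
      rw [List.getD_append_right _ _ _ _ (by simpa using h), List.length_insertionSort]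
      have := hb.2 _ hi'
      rw [List.getD_eq_getElem _ _ (by simpa using hi')] at this ⊢
      rw [List.getElem_map]
      omega

theorem slash_length (a b : W) : (slashProd a b).length = a.length + b.length := by
  simp [slashProd, shiftW, add_comm]

theorem mem_Rset {a b : W} {Θ : Finset (W × W)} : Θ ∈ Rset a b ↔
    (∀ p ∈ Θ, p.1 ∈ GS a ∧ p.2 ∈ sh a.length (GS b)) ∧
    ∀ p ∈ Θ, ∀ q ∈ Θ, (p.1 = q.1 ∨ p.2 = q.2) → p = q := by
  rw [Rset, Finset.mem_filter, Finset.mem_powerset, shiftF_toFinset]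
  refine and_congr_left (fun _ => ?_)
  constructor
  · intro h p hp
    exact Finset.mem_product.1 (h hp)
  · intro h p hp
    exact Finset.mem_product.2 (h p hp)

theorem mTheta_eq (a b : W) (Θ : Finset (W × W)) :
    mTheta a b Θ = wordOfSet (glueSet (GS a) (sh a.length (GS b)) Θ) := by
  rw [mTheta, shiftF_toFinset]
  rfl

/-- For `a ∈ P_m`, `b ∈ P_n`:
`A(a,b) = { ãΘb̃ : a ≤_* ã, b ≤_* b̃, Θ ∈ R(ã,b̃) }` equals
`B(a,b) = { c ∈ P_{m+n} : a|b ≤_* c }`. -/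
theorem stmt15 (m n : ℕ) (a b : W) (ha : IsPF a) (hla : a.length = m)
    (hb : IsPF b) (hlb : b.length = n) :
    {c : W | ∃ ta tb : W, ∃ Θ : Finset (W × W),
        IsPF ta ∧ ta.length = m ∧ IsPF tb ∧ tb.length = n ∧
        leStar a ta ∧ leStar b tb ∧ Θ ∈ Rset ta tb ∧ c = mTheta ta tb Θ} =
      {c : W | IsPF c ∧ c.length = m + n ∧ leStar (slashProd a b) c} := by
  have hla' := ha.le_length
  have hSV : VS (GS a ∪ sh a.length (GS b)) := by
    rw [← GS_slash hla' hb.1]; exact VS_GS _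
  have hX := allP_GS hla'
  have hY := allP_sh (m := a.length) hb.1
  have hsl := slash_length a b
  ext c
  simp only [Set.mem_setOf_eq]
  constructor
  · rintro ⟨ta, tb, Θ, hta, hlta, htb, hltb, h1, h2, hΘ, rfl⟩
    have hll : ta.length = a.length := by omega
    obtain ⟨hΘ1, hΘ2⟩ := mem_Rset.1 hΘ
    rw [mTheta_eq]
    rw [hll] at hΘ1 ⊢
    have r1 := steps_union_left hX hY h1.steps
    have hX' := steps_allP h1.steps hX
    have s2 := steps_sh (m := a.length) h2.steps
    have r2 := steps_union_right hX' hY s2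
    have hY' := steps_allP s2 hY
    have r3 := steps_glue hX' hY' Θ hΘ1 hΘ2
    have r := (r1.trans r2).trans r3
    have hle := steps_leStar hSV r
    rw [← GS_slash hla' hb.1, wordOfSet_GS] at hle
    have hp := hle.perm
    exact ⟨(ha.slash hb).perm hp, by rw [hp.length_eq]; omega, hle⟩
  · rintro ⟨hc, hlc, h⟩
    have hs := h.steps
    rw [GS_slash hla' hb.1] at hs
    obtain ⟨i1, i2⟩ := inv_union hSV hX hY
    obtain ⟨j1, k1⟩ := steps_prj hs i1
    obtain ⟨j2, k2⟩ := steps_prj hs i2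
    rw [prj_lo_union hX hY] at k1
    rw [prj_hi_union hX hY] at k2
    obtain ⟨T, k3, hT⟩ := steps_unsh k2
    have hg := steps_good hs (good_union hX hY)
    have vA := steps_VS k1 (VS_GS a)
    have vB := steps_VS k3 (VS_GS b)
    have l1 := steps_leStar (VS_GS a) k1
    have l2 := steps_leStar (VS_GS b) k3
    rw [wordOfSet_GS] at l1 l2
    have len1 := l1.perm.length_eq
    have len2 := l2.perm.length_eq
    refine ⟨_, _, thetaOf a.length (GS c), ha.perm l1.perm, by omega, hb.perm l2.perm, by omega,
      l1, l2, ?_, ?_⟩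
    · rw [mem_Rset, GS_wordOfSet vA, GS_wordOfSet vB, len1, ← hT]
      exact ⟨thetaOf_sub, thetaOf_matching j1 j2⟩
    · rw [mTheta_eq, GS_wordOfSet vA, GS_wordOfSet vB, len1, ← hT,
        glue_prj (fun w hw => ((VS_GS c).1 w hw).1) hg j1 j2, wordOfSet_GS]
end

section
/- For each of the families X ∈ {N, D, S}: if a ∈ X_m, b ∈ X_n and Θ ∈ R(a,b), then aΘb ∈ X_{m+n}; and if a ∈ X_n and a' is a subword of a with F_{a'} ⊆ F_a, then Park(a') ∈ X_{l(a')}. Moreover, if a ∈ C_m and b ∈ C_n then a|b ∈ C_{m+n}, and if a ∈ C_n and a' is a subword of a with F_{a'} ⊆ F_a then Park(a') ∈ C_{l(a')}. Consequently, the spans of {M_a : a ∈ ∪_n N_n}, {M_a : a ∈ ∪_n D_n}, {M_a : a ∈ ∪_n S_n}, and of {Q_a : a ∈ ∪_n C_n} are closed under the product ⋆ and the coproduct Δ of PFSym. -/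
open scoped Classical

/-- The span of the monomial basis elements indexed by parking functions with
property `P`. -/
noncomputable def spanM (K : Type) [Field K] (P : W → Prop) : Submodule K (FW K) :=
  Submodule.span K {z : FW K | ∃ a : W, IsPF a ∧ P a ∧ z = Mb K a}

/-- The span, inside the tensor square, of the elements `M_a ⊗ M_b` with `a`, `b`
parking functions with property `P`. -/
noncomputable def spanM2 (K : Type) [Field K] (P : W → Prop) : Submodule K (FW2 K) :=
  Submodule.span K {z : FW2 K | ∃ p : W × W,
    IsPF p.1 ∧ P p.1 ∧ IsPF p.2 ∧ P p.2 ∧ z = Finsupp.single p (1 : K)}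

/-- The span of the `Q`-basis elements indexed by parking functions with
property `P`. -/
noncomputable def spanQ (K : Type) [Field K] (P : W → Prop) : Submodule K (FW K) :=
  Submodule.span K {z : FW K | ∃ a : W, IsPF a ∧ P a ∧ z = Qb K a}

/-- The span, inside the tensor square, of the elements `Q_a ⊗ Q_b` with `a`, `b`
parking functions with property `P`. -/
noncomputable def spanQ2 (K : Type) [Field K] (P : W → Prop) : Submodule K (FW2 K) :=
  Submodule.span K {z : FW2 K | ∃ p : W × W,
    IsPF p.1 ∧ P p.1 ∧ IsPF p.2 ∧ P p.2 ∧ z = QT K p.1 p.2}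

/-- Closure of a family `X_n = {a ∈ P_n : P a}` under the product `aΘb`. -/
def MulClosed (P : W → Prop) : Prop :=
  ∀ a b : W, IsPF a → IsPF b → P a → P b → ∀ Θ ∈ Rset a b,
    IsPF (mTheta a b Θ) ∧ P (mTheta a b Θ) ∧
      (mTheta a b Θ).length = a.length + b.length

/-- Closure of a family `X_n = {a ∈ P_n : P a}` under parkization of subwords
selected from the LR-decomposition. -/
def ParkClosed (P : W → Prop) : Prop :=
  ∀ a : W, IsPF a → P a → ∀ S ∈ ((LR a).toFinset).powerset,
    IsPF (Park (subWord a S)) ∧ P (Park (subWord a S)) ∧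
      (Park (subWord a S)).length = (subWord a S).length


namespace PFaux

/-- first letter -/
def hd (w : W) : ℕ := w.headD 0

/-- dominated words with strictly decreasing heads -/
def SD (L : List W) : Prop :=
  (∀ w ∈ L, Dominated w) ∧ L.Pairwise (fun u v => hd v < hd u)

theorem segs_nil : segs [] = [] := by rw [segs]

theorem segs_cons (x : ℕ) (xs : W) : segs (x :: xs) =
    (x :: xs.takeWhile fun y => x ≤ y) :: segs (xs.dropWhile fun y => x ≤ y) := by
  rw [segs]

theorem segs_flatten (a : W) : (segs a).flatten = a := by
  induction h : a.length using Nat.strong_induction_on generalizing a with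
  | _ n ih =>
    cases a with
    | nil => simp [segs_nil]
    | cons x xs =>
      rw [segs_cons, List.flatten_cons, ih _ _ _ rfl]
      · simp
      · subst h
        simpa using Nat.lt_succ_of_le (List.dropWhile_sublist _).length_le

theorem segs_SD (a : W) : SD (segs a) := by
  induction h : a.length using Nat.strong_induction_on generalizing a with
  | _ n ih =>
    cases a with
    | nil => simp [segs_nil, SD]
    | cons x xs =>
      have h1 : SD (segs (xs.dropWhile fun y => x ≤ y)) := by
        refine ih _ ?_ _ rfl
        subst h
        simpa using Nat.lt_succ_of_le (List.dropWhile_sublist _).length_le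
      rw [segs_cons]
      refine ⟨?_, ?_⟩
      · intro w hw
        rcases List.mem_cons.1 hw with rfl | hw
        · refine ⟨by simp, ?_⟩
          intro y hy
          rcases List.mem_cons.1 hy with rfl | hy
          · simp
          · simpa using List.mem_takeWhile_imp hy
        · exact h1.1 w hw
      · refine List.pairwise_cons.2 ⟨?_, h1.2⟩
        intro v hv
        cases hd' : xs.dropWhile fun y => x ≤ y with
        | nil => rw [hd', segs_nil] at hv; simp at hv
        | cons z zs =>
          have hz : z < x := by
            have := List.head_dropWhile_not (l := xs) (fun y => decide (x ≤ y)) (by rw [hd']; simp)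
            simp only [hd', List.head_cons] at this
            simpa using this
          rw [hd', segs_cons] at hv h1
          rcases List.mem_cons.1 hv with rfl | hv
          · simpa [hd] using hz
          · have := (List.pairwise_cons.1 h1.2).1 v hv
            simp [hd] at this ⊢
            omega

theorem segs_of_SD (L : List W) (h : SD L) : segs L.flatten = L := by
  induction L with
  | nil => simp [segs_nil]
  | cons w L ih =>
    have hL : SD L := ⟨fun u hu => h.1 u (List.mem_cons_of_mem _ hu), (List.pairwise_cons.1 h.2).2⟩
    have hw := h.1 w (List.mem_cons_self)
    cases w with
    | nil => exact absurd rfl hw.1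
    | cons x xs =>
      have h1 : ∀ y ∈ xs, decide (x ≤ y) = true := by
        intro y hy
        simpa using hw.2 y (List.mem_cons_of_mem _ hy)
      have h2 : L.flatten.takeWhile (fun y => decide (x ≤ y)) = [] ∧
          L.flatten.dropWhile (fun y => decide (x ≤ y)) = L.flatten := by
        cases L with
        | nil => simp
        | cons v L' =>
          have hv := h.1 v (by simp)
          have hlt := (List.pairwise_cons.1 h.2).1 v (by simp)
          cases v with
          | nil => exact absurd rfl hv.1
          | cons z zs =>
            simp [hd] at hlt
            simp [hlt]
      rw [List.flatten_cons, List.cons_append, segs_cons,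
        List.takeWhile_append_of_pos h1, List.dropWhile_append_of_pos h1, h2.1, h2.2, ih hL]
      simp

/-- the LR decomposition as a multiset -/
def MS (a : W) : Multiset W := (LR a : Multiset W)

/-- multisets coming from words -/
def Good (M : Multiset W) : Prop := (∀ w ∈ M, Dominated w) ∧ (M.map hd).Nodup

theorem SD_unique {L L' : List W} (h : SD L) (h' : SD L') (hp : L.Perm L') : L = L' := by
  refine List.Perm.eq_of_pairwise ?_ h.2 h'.2 hp
  intro a b _ _ h1 h2
  omega

theorem MS_eq (a : W) : MS a = (segs a : Multiset W) := by
  simp [MS, LR]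

theorem good_of_SD {L : List W} (h : SD L) : Good (L : Multiset W) := by
  refine ⟨by simpa using h.1, ?_⟩
  rw [Multiset.map_coe, Multiset.coe_nodup, List.Nodup, List.pairwise_map]
  exact h.2.imp (fun h => by omega)

theorem good_MS (a : W) : Good (MS a) := by
  rw [MS_eq]; exact good_of_SD (segs_SD a)

theorem MS_of_SD {L : List W} (h : SD L) : MS L.flatten = (L : Multiset W) := by
  rw [MS_eq, segs_of_SD L h]

theorem MS_inj {a b : W} (h : MS a = MS b) : a = b := by
  rw [MS_eq, MS_eq, Multiset.coe_eq_coe] at h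
  rw [← segs_flatten a, ← segs_flatten b, SD_unique (segs_SD a) (segs_SD b) h]

theorem Good.nodup {M : Multiset W} (h : Good M) : M.Nodup := Multiset.Nodup.of_map _ h.2

theorem Good.inj {M : Multiset W} (h : Good M) {u v : W} (hu : u ∈ M) (hv : v ∈ M)
    (e : hd u = hd v) : u = v := Multiset.inj_on_of_nodup_map h.2 u hu v hv e

theorem Good.mono {M N : Multiset W} (h : Good M) (hN : N ≤ M) : Good N :=
  ⟨fun w hw => h.1 w (Multiset.mem_of_le hN hw), Multiset.nodup_of_le (Multiset.map_le_map hN) h.2⟩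

theorem wordOfSet_spec (G : Finset W) (h : Good G.val) : MS (wordOfSet G) = G.val := by
  have hp : (G.sort (· ≤ ·)).Pairwise (· ≤ ·) := Finset.pairwise_sort G _
  have hn : (G.sort (· ≤ ·)).Nodup := Finset.sort_nodup G _
  have hv : ((G.sort (· ≤ ·) : List W) : Multiset W) = G.val := Finset.sort_eq _ _
  have : SD (G.sort (· ≤ ·)).reverse := by
    refine ⟨fun w hw => h.1 w ?_, ?_⟩
    · simpa using hw
    · rw [List.pairwise_reverse]
      refine ((hp.and hn)).imp_of_mem ?_
      rintro u v hu hv' ⟨h1, h2⟩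
      have hu' : u ∈ G.val := by simpa using hu
      have hv'' : v ∈ G.val := by simpa using hv'
      have hne : hd u ≠ hd v := fun e => h2 (h.inj hu' hv'' e)
      have du := (h.1 u hu').1
      have dv := (h.1 v hv'').1
      cases u with
      | nil => exact absurd rfl du
      | cons x xs =>
        cases v with
        | nil => exact absurd rfl dv
        | cons y ys =>
          have h1' : List.Lex (· < ·) (x :: xs) (y :: ys) := lt_of_le_of_ne h1 h2
          rw [List.cons_lex_cons_iff] at h1'
          simp [hd] at hne ⊢
          tauto
  rw [wordOfSet, MS_of_SD this, ← hv, Multiset.coe_eq_coe]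
  exact List.reverse_perm _

theorem FS_val (a : W) : (LR a).toFinset.val = MS a := by
  rw [List.toFinset_val, List.dedup_eq_self.2, MS]
  have := (good_MS a).nodup
  rwa [MS, Multiset.coe_nodup] at this

theorem exists_word {M : Multiset W} (h : Good M) : ∃ a, MS a = M :=
  ⟨wordOfSet ⟨M, h.nodup⟩, wordOfSet_spec ⟨M, h.nodup⟩ h⟩

theorem wordOfSet_FS (a : W) : wordOfSet (LR a).toFinset = a := by
  apply MS_inj
  rw [wordOfSet_spec, FS_val]
  rw [FS_val]; exact good_MS a

theorem mem_FS {a w : W} : w ∈ (LR a).toFinset ↔ w ∈ MS a := by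
  rw [← FS_val]; rfl

/-- letters of a multiset of words -/
def lett (M : Multiset W) : Multiset ℕ := (M.map (fun w => (w : Multiset ℕ))).sum

@[simp] theorem lett_zero : lett 0 = 0 := rfl
@[simp] theorem lett_cons (w : W) (M : Multiset W) : lett (w ::ₘ M) = (w : Multiset ℕ) + lett M := by
  simp [lett]
@[simp] theorem lett_add (M N : Multiset W) : lett (M + N) = lett M + lett N := by
  simp [lett]

theorem lett_coe (L : List W) : lett (L : Multiset W) = (L.flatten : Multiset ℕ) := by
  induction L with
  | nil => rfl
  | cons w L ih =>
    rw [← Multiset.cons_coe, lett_cons, ih]; rfl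

theorem lett_MS (a : W) : lett (MS a) = (a : Multiset ℕ) := by
  rw [MS_eq, lett_coe, segs_flatten]

theorem mem_lett {M : Multiset W} {x : ℕ} : x ∈ lett M ↔ ∃ w ∈ M, x ∈ w := by
  induction M using Multiset.induction_on with
  | empty => simp
  | cons w M ih => simp [ih]

theorem mem_of_MS {a w : W} {x : ℕ} (hw : w ∈ MS a) (hx : x ∈ w) : x ∈ a := by
  have : x ∈ lett (MS a) := mem_lett.2 ⟨w, hw, hx⟩
  rwa [lett_MS] at this

theorem hd_mem {w : W} (h : Dominated w) : hd w ∈ w := by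
  cases w with
  | nil => exact absurd rfl h.1
  | cons x xs => simp [hd]

theorem hd_le {w : W} (h : Dominated w) {x : ℕ} (hx : x ∈ w) : hd w ≤ x := h.2 x hx

/-- subset of a good multiset is determined by its letters -/
theorem lett_inj {A S T : Multiset W} (hA : Good A) (hS : S ≤ A) (hT : T ≤ A)
    (h : lett S = lett T) : S = T := by
  induction hn : S.card using Nat.strong_induction_on generalizing A S T with
  | _ n ih =>
    by_cases h0 : lett S = 0
    · have : ∀ U : Multiset W, U ≤ A → lett U = 0 → U = 0 := by
        intro U hU h0
        refine Multiset.eq_zero_of_forall_notMem fun w hw => ?_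
        have : hd w ∈ lett U := mem_lett.2 ⟨w, hw, hd_mem (hA.1 w (Multiset.mem_of_le hU hw))⟩
        rw [h0] at this; simp at this
      rw [this S hS h0, this T hT (h ▸ h0)]
    · obtain ⟨x0, hx0⟩ := Multiset.exists_mem_of_ne_zero h0
      have hex : ∃ x, x ∈ lett S := ⟨x0, hx0⟩
      set x := Nat.find hex with hx
      have hxm : x ∈ lett S := Nat.find_spec hex
      have hmin : ∀ y ∈ lett S, x ≤ y := fun y hy => Nat.find_min' hex hy
      have key : ∀ U : Multiset W, U ≤ A → lett U = lett S → ∃ w ∈ U, hd w = x := by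
        intro U hU e
        obtain ⟨w, hw, hxw⟩ := mem_lett.1 (e ▸ hxm)
        have hd' := hA.1 w (Multiset.mem_of_le hU hw)
        refine ⟨w, hw, le_antisymm (hd_le hd' hxw) (hmin _ (e ▸ mem_lett.2 ⟨w, hw, hd_mem hd'⟩))⟩
      obtain ⟨w, hw, e1⟩ := key S hS rfl
      obtain ⟨w', hw', e2⟩ := key T hT h.symm
      have : w = w' := hA.inj (Multiset.mem_of_le hS hw) (Multiset.mem_of_le hT hw') (by rw [e1, e2])
      subst this
      obtain ⟨S', rfl⟩ := Multiset.exists_cons_of_mem hw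
      obtain ⟨T', rfl⟩ := Multiset.exists_cons_of_mem hw'
      rw [ih S'.card (by simp at hn; omega) hA ((Multiset.le_cons_self _ _).trans hS)
        ((Multiset.le_cons_self _ _).trans hT) (by simpa using h) rfl]

end PFaux


namespace PFaux

/-- number of letters at most i -/
def cnt (a : W) (i : ℕ) : ℕ := a.countP (fun x => decide (x ≤ i))

theorem cnt_perm {a b : W} (h : a.Perm b) (i : ℕ) : cnt a i = cnt b i := h.countP_eq _

theorem sorted_cnt (l : W) (hl : l.Pairwise (· ≤ ·)) (i k : ℕ) (hi : i < l.length) :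
    l.getD i 0 ≤ k ↔ i + 1 ≤ cnt l k := by
  induction l generalizing i with
  | nil => simp at hi
  | cons x xs ih =>
    rw [List.pairwise_cons] at hl
    by_cases hx : x ≤ k
    · have : cnt (x :: xs) k = cnt xs k + 1 := by simp [cnt, hx]
      rw [this]
      cases i with
      | zero => simp [hx]
      | succ i =>
        simp at hi
        simpa using ih hl.2 i hi
    · have h0 : cnt (x :: xs) k = 0 := by
        rw [cnt, List.countP_eq_zero]
        intro y hy
        rcases List.mem_cons.1 hy with rfl | hy
        · simpa using hx
        · have := hl.1 y hy
          simp; omega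
      rw [h0]
      have : x ≤ (x :: xs).getD i 0 := by
        rw [List.getD_eq_getElem _ _ hi]
        rcases List.mem_cons.1 (List.getElem_mem hi) with h | h
        · exact h.ge
        · exact hl.1 _ h
      omega

theorem isPF_iff (a : W) : IsPF a ↔ (∀ x ∈ a, 1 ≤ x) ∧ ∀ i, i ≤ a.length → i ≤ cnt a i := by
  unfold IsPF
  refine and_congr_right fun _ => ?_
  have hs : (a.insertionSort (· ≤ ·)).Pairwise (· ≤ ·) := List.pairwise_insertionSort _ _
  have hp : (a.insertionSort (· ≤ ·)).Perm a := List.perm_insertionSort _ _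
  constructor
  · intro h i hi
    cases i with
    | zero => simp
    | succ i =>
      have := (sorted_cnt _ hs i (i + 1) (by rw [hp.length_eq]; omega)).1 (h i (by omega))
      rwa [cnt_perm hp] at this
  · intro h i hi
    refine (sorted_cnt _ hs i (i + 1) (by rw [hp.length_eq]; omega)).2 ?_
    rw [cnt_perm hp]
    exact h (i + 1) (by omega)

theorem isPF_perm {a b : W} (h : a.Perm b) (ha : IsPF a) : IsPF b := by
  rw [isPF_iff] at ha ⊢
  refine ⟨fun x hx => ha.1 x (h.mem_iff.2 hx), fun i hi => ?_⟩
  rw [← cnt_perm h]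
  exact ha.2 i (by rwa [h.length_eq])

theorem isPF_le {a : W} (ha : IsPF a) {x : ℕ} (hx : x ∈ a) : x ≤ a.length := by
  have h := ((isPF_iff a).1 ha).2 a.length le_rfl
  have h2 : cnt a a.length = a.length := le_antisymm List.countP_le_length h
  rw [cnt, List.countP_eq_length] at h2
  simpa using h2 x hx

theorem isPF_append {a b : W} (ha : IsPF a) (hb : IsPF b) : IsPF (a ++ shiftW a.length b) := by
  have ha' := (isPF_iff a).1 ha
  have hb' := (isPF_iff b).1 hb
  rw [isPF_iff]
  refine ⟨?_, ?_⟩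
  · intro x hx
    rcases List.mem_append.1 hx with hx | hx
    · exact ha'.1 x hx
    · obtain ⟨y, hy, rfl⟩ := List.mem_map.1 hx
      have := hb'.1 y hy
      omega
  · intro i hi
    have e : cnt (a ++ shiftW a.length b) i = cnt a i + cnt (shiftW a.length b) i := by
      simp [cnt]
    rw [e]
    by_cases h : i ≤ a.length
    · have := ha'.2 i h
      omega
    · have h1 : a.length ≤ cnt a i := by
        refine (ha'.2 a.length le_rfl).trans (List.countP_mono_left ?_)
        intro x _ hx
        simp at hx ⊢
        omega
      have h2 : cnt (shiftW a.length b) i = cnt b (i - a.length) := by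
        rw [cnt, shiftW, List.countP_map, cnt]
        apply List.countP_congr
        intro x _
        simp
        omega
      have := hb'.2 (i - a.length) (by simp [shiftW] at hi; omega)
      omega

theorem dVal_perm {a b : W} (h : a.Perm b) : dVal a = dVal b := by
  unfold dVal
  have : (fun i => (a.filter (fun x => x ≤ i)).length < i) =
      (fun i => (b.filter (fun x => x ≤ i)).length < i) := by
    funext i
    rw [(h.filter _).length_eq]
  simp only [this]

theorem dVal_spec (a : W) : cnt a (dVal a) < dVal a := by
  have := Nat.find_spec (p := fun i => (a.filter (fun x => x ≤ i)).length < i)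
    ⟨a.length + 1, Nat.lt_succ_of_le (List.length_filter_le _ _)⟩
  rw [cnt, List.countP_eq_length_filter]
  exact this

theorem dVal_min (a : W) {i : ℕ} (h : i < dVal a) : i ≤ cnt a i := by
  have := Nat.find_min (p := fun i => (a.filter (fun x => x ≤ i)).length < i)
    ⟨a.length + 1, Nat.lt_succ_of_le (List.length_filter_le _ _)⟩ h
  rw [cnt, List.countP_eq_length_filter]
  omega

theorem dVal_le (a : W) : dVal a ≤ a.length + 1 := by
  by_contra h
  have := dVal_min a (i := a.length + 1) (by omega)
  have h2 : cnt a (a.length + 1) ≤ a.length := List.countP_le_length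
  omega

theorem dVal_pos (a : W) : 0 < dVal a := by
  have := dVal_spec a
  omega

theorem dVal_notMem (a : W) : dVal a ∉ a := by
  intro h
  have h1 := dVal_spec a
  have h2 := dVal_min a (i := dVal a - 1) (by have := dVal_pos a; omega)
  have h3 : cnt a (dVal a - 1) + a.count (dVal a) ≤ cnt a (dVal a) := by
    have hp := dVal_pos a
    generalize dVal a = d at *
    clear h h1 h2
    induction a with
    | nil => simp [cnt]
    | cons x xs ih =>
      simp only [cnt, List.countP_cons, List.count_cons] at ih ⊢
      rcases lt_trichotomy x d with hx | hx | hx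
      · have : x ≤ d - 1 := by omega
        have : x ≤ d := by omega
        have : ¬ x = d := by omega
        simp [*]; omega
      · subst hx
        have : ¬ x ≤ x - 1 := by omega
        simp [*]; omega
      · have : ¬ x ≤ d - 1 := by omega
        have : ¬ x ≤ d := by omega
        have : ¬ x = d := by omega
        simp [*]
  have h4 := List.count_pos_iff.2 h
  omega

/-- the one-step relabelling -/
def stepFn (a : W) (x : ℕ) : ℕ := if dVal a < x then x - 1 else x

theorem stepFn_mono (a : W) : StrictMonoOn (stepFn a) {x | x ∈ a} := by
  intro x hx y hy hxy
  have h1 : x ≠ dVal a := fun e => dVal_notMem a (e ▸ hx)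
  have h2 : y ≠ dVal a := fun e => dVal_notMem a (e ▸ hy)
  simp only [stepFn]
  split_ifs <;> omega

theorem parkFuel_map (k : ℕ) (a : W) : ∃ φ : ℕ → ℕ, StrictMonoOn φ {x | x ∈ a} ∧
    ∀ s : W, s.Perm a → parkFuel k s = s.map φ := by
  induction k generalizing a with
  | zero => exact ⟨id, strictMono_id.strictMonoOn _, fun s _ => by simp [parkFuel]⟩
  | succ k ih =>
    by_cases h : dVal a = a.length + 1
    · refine ⟨id, strictMono_id.strictMonoOn _, fun s hs => ?_⟩
      rw [parkFuel, if_pos]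
      · simp
      · rw [dVal_perm hs, hs.length_eq, h]
    · obtain ⟨φ, h1, h2⟩ := ih (parkStep a)
      refine ⟨φ ∘ stepFn a, ?_, ?_⟩
      · refine h1.comp (stepFn_mono a) ?_
        intro x hx
        exact List.mem_map.2 ⟨x, hx, rfl⟩
      · intro s hs
        have e : parkStep s = s.map (stepFn a) := by
          unfold parkStep stepFn
          rw [dVal_perm hs]
        rw [parkFuel, if_neg, h2, e, List.map_map]
        · rw [e]; exact hs.map _
        · rwa [dVal_perm hs, hs.length_eq]

theorem Park_map (a : W) : ∃ φ : ℕ → ℕ, StrictMonoOn φ {x | x ∈ a} ∧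
    ∀ s : W, s.Perm a → Park s = s.map φ := by
  obtain ⟨φ, h1, h2⟩ := parkFuel_map a.sum a
  refine ⟨φ, h1, fun s hs => ?_⟩
  rw [Park, hs.sum_eq, h2 s hs]

theorem isPF_of_dVal {a : W} (hp : ∀ x ∈ a, 1 ≤ x) (h : dVal a = a.length + 1) : IsPF a := by
  rw [isPF_iff]
  exact ⟨hp, fun i hi => dVal_min a (by omega)⟩

theorem sum_step_lt (d : ℕ) (a : W) (h : ∃ x ∈ a, d < x) :
    (a.map fun x => if d < x then x - 1 else x).sum < a.sum := by
  have := List.sum_lt_sum (l := a) (fun x => if d < x then x - 1 else x) id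
    (by intro x _; simp only [id]; split_ifs <;> omega)
    (by
      obtain ⟨x, hx, h⟩ := h
      exact ⟨x, hx, by simp [h]; omega⟩)
  simpa using this

theorem parkFuel_isPF (k : ℕ) (a : W) (hp : ∀ x ∈ a, 1 ≤ x) (hk : a.sum ≤ k) :
    IsPF (parkFuel k a) := by
  induction k generalizing a with
  | zero =>
    cases a with
    | nil => simp [parkFuel, IsPF]
    | cons x xs =>
      have := hp x (by simp)
      simp at hk; omega
  | succ k ih =>
    rw [parkFuel]
    split_ifs with h
    · exact isPF_of_dVal hp h
    · have hd := dVal_pos a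
      apply ih
      · intro x hx
        obtain ⟨y, hy, rfl⟩ := List.mem_map.1 hx
        have := hp y hy
        split_ifs <;> omega
      · have : (parkStep a).sum < a.sum := by
          apply sum_step_lt
          by_contra hc
          push Not at hc
          have h1 := dVal_spec a
          have h2 : cnt a (dVal a) = a.length := by
            rw [cnt, List.countP_eq_length]
            simpa using hc
          have := dVal_le a
          omega
        omega

theorem Park_isPF (a : W) (hp : ∀ x ∈ a, 1 ≤ x) : IsPF (Park a) :=
  parkFuel_isPF _ _ hp le_rfl

end PFaux


namespace PFaux

theorem hd_map {w : W} (h : w ≠ []) (φ : ℕ → ℕ) : hd (w.map φ) = φ (hd w) := by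
  cases w with
  | nil => exact absurd rfl h
  | cons x xs => simp [hd]

theorem hd_append {u v : W} (h : u ≠ []) : hd (u ++ v) = hd u := by
  cases u with
  | nil => exact absurd rfl h
  | cons x xs => simp [hd]

theorem dom_map {w : W} {φ : ℕ → ℕ} (h : Dominated w) (hφ : MonotoneOn φ {x | x ∈ w}) :
    Dominated (w.map φ) := by
  refine ⟨by simpa using h.1, ?_⟩
  intro y hy
  obtain ⟨x, hx, rfl⟩ := List.mem_map.1 hy
  change hd _ ≤ _
  rw [hd_map h.1]
  exact hφ (hd_mem h) hx (hd_le h hx)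

theorem MS_map {a : W} {φ : ℕ → ℕ} (hφ : StrictMonoOn φ {x | x ∈ a}) :
    MS (a.map φ) = (MS a).map (List.map φ) := by
  have h := segs_SD a
  have hsub : ∀ w ∈ segs a, ∀ x ∈ w, x ∈ a := by
    intro w hw x hx
    exact mem_of_MS (w := w) (by rw [MS_eq]; simpa using hw) hx
  have h' : SD ((segs a).map (List.map φ)) := by
    refine ⟨?_, ?_⟩
    · intro w hw
      obtain ⟨u, hu, rfl⟩ := List.mem_map.1 hw
      exact dom_map (h.1 u hu) (hφ.monotoneOn.mono (hsub u hu))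
    · rw [List.pairwise_map]
      refine h.2.imp_of_mem ?_
      intro u v hu hv huv
      rw [hd_map (h.1 u hu).1, hd_map (h.1 v hv).1]
      exact hφ (hsub v hv _ (hd_mem (h.1 v hv))) (hsub u hu _ (hd_mem (h.1 u hu))) huv
  have e : ((segs a).map (List.map φ)).flatten = a.map φ := by
    rw [← List.map_flatten, segs_flatten]
  rw [← e, MS_of_SD h', MS_eq]
  simp

/-- covering relation on multisets -/
def Step (M N : Multiset W) : Prop :=
  ∃ u v R, M = u ::ₘ v ::ₘ R ∧ N = (u ++ v) ::ₘ R ∧ ∀ x ∈ u, ∀ y ∈ v, x ≤ y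

/-- order on multisets -/
def Le (M N : Multiset W) : Prop := Relation.ReflTransGen Step M N

theorem Step.lett_eq {M N : Multiset W} (h : Step M N) : lett M = lett N := by
  obtain ⟨u, v, R, rfl, rfl, _⟩ := h
  simp only [lett_cons, ← Multiset.coe_add, add_assoc]

theorem Le.lett_eq {M N : Multiset W} (h : Le M N) : lett M = lett N := by
  induction h with
  | refl => rfl
  | tail _ h ih => rw [ih, h.lett_eq]

theorem Step.good {M N : Multiset W} (h : Step M N) (hM : Good M) : Good N := by
  obtain ⟨u, v, R, rfl, rfl, huv⟩ := h
  have du := hM.1 u (by simp)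
  refine ⟨?_, ?_⟩
  · intro w hw
    rcases Multiset.mem_cons.1 hw with rfl | hw
    · refine ⟨by simp [du.1], ?_⟩
      intro x hx
      change hd _ ≤ _
      rw [hd_append du.1]
      rcases List.mem_append.1 hx with hx | hx
      · exact hd_le du hx
      · exact huv _ (hd_mem du) x hx
    · exact hM.1 w (by simp [hw])
  · have := hM.2
    simp only [Multiset.map_cons, hd_append du.1] at this ⊢
    rw [Multiset.nodup_cons] at this ⊢
    rw [Multiset.nodup_cons] at this
    simp at this ⊢
    tauto

theorem Le.good {M N : Multiset W} (h : Le M N) (hM : Good M) : Good N := by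
  induction h with
  | refl => exact hM
  | tail _ h ih => exact h.good ih

theorem Step.add {M N : Multiset W} (h : Step M N) (R : Multiset W) : Step (M + R) (N + R) := by
  obtain ⟨u, v, S, rfl, rfl, h⟩ := h
  exact ⟨u, v, S + R, by simp, by simp, h⟩

theorem Le.add_right {M N : Multiset W} (h : Le M N) (R : Multiset W) : Le (M + R) (N + R) := by
  induction h with
  | refl => exact Relation.ReflTransGen.refl
  | tail _ h ih => exact Relation.ReflTransGen.tail ih (h.add R)

theorem Le.add {M N M' N' : Multiset W} (h : Le M N) (h' : Le M' N') : Le (M + M') (N + N') := by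
  refine Relation.ReflTransGen.trans (h.add_right M') ?_
  rw [add_comm N, add_comm N]
  exact h'.add_right N

theorem Step.map {M N : Multiset W} (h : Step M N) {φ : ℕ → ℕ}
    (hφ : MonotoneOn φ {x | x ∈ lett M}) : Step (M.map (List.map φ)) (N.map (List.map φ)) := by
  obtain ⟨u, v, S, rfl, rfl, h⟩ := h
  refine ⟨u.map φ, v.map φ, S.map (List.map φ), by simp, by simp, ?_⟩
  intro x hx y hy
  obtain ⟨x, hx', rfl⟩ := List.mem_map.1 hx
  obtain ⟨y, hy', rfl⟩ := List.mem_map.1 hy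
  exact hφ (by simp [hx']) (by simp [hy']) (h x hx' y hy')

theorem Le.map {M N : Multiset W} (h : Le M N) {φ : ℕ → ℕ}
    (hφ : MonotoneOn φ {x | x ∈ lett M}) : Le (M.map (List.map φ)) (N.map (List.map φ)) := by
  induction h with
  | refl => exact Relation.ReflTransGen.refl
  | tail h1 h ih =>
    refine Relation.ReflTransGen.tail ih (h.map ?_)
    rwa [← Le.lett_eq h1]

theorem Le.split {A T1 T2 : Multiset W} (h : Le A (T1 + T2)) :
    ∃ S1 S2, A = S1 + S2 ∧ Le S1 T1 ∧ Le S2 T2 := by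
  generalize hG : T1 + T2 = G at h
  induction h generalizing T1 T2 with
  | refl => exact ⟨T1, T2, hG.symm, .refl, .refl⟩
  | tail _ h ih =>
    obtain ⟨u, v, R, rfl, rfl, huv⟩ := h
    have hm : u ++ v ∈ T1 + T2 := by rw [hG]; simp
    rcases Multiset.mem_add.1 hm with hm | hm
    · obtain ⟨T, rfl⟩ := Multiset.exists_cons_of_mem hm
      simp only [Multiset.cons_add, Multiset.cons_inj_right] at hG
      obtain ⟨S1, S2, e, h1, h2⟩ := ih (T1 := u ::ₘ v ::ₘ T) (T2 := T2) (by simp [hG])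
      exact ⟨S1, S2, e, h1.tail ⟨u, v, T, rfl, rfl, huv⟩, h2⟩
    · obtain ⟨T, rfl⟩ := Multiset.exists_cons_of_mem hm
      simp only [Multiset.add_cons, Multiset.cons_inj_right] at hG
      obtain ⟨S1, S2, e, h1, h2⟩ := ih (T1 := T1) (T2 := u ::ₘ v ::ₘ T) (by simp [hG])
      exact ⟨S1, S2, e, h1, h2.tail ⟨u, v, T, rfl, rfl, huv⟩⟩

theorem LR_pairwise (a : W) : (LR a).Pairwise (fun u v => hd u < hd v) := by
  rw [LR, List.pairwise_reverse]; exact (segs_SD a).2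

theorem perm_aux (L : List W) (i j : ℕ) (z : W) (hij : i < j) (hj : j < L.length) :
    ∃ R : List W, L.Perm (L[i] :: L[j] :: R) ∧ ((L.set i z).eraseIdx j).Perm (z :: R) := by
  have hi' : i < (L.eraseIdx j).length := by rw [List.length_eraseIdx_of_lt hj]; omega
  have hi'' : i < ((L.set i z).eraseIdx j).length := by
    rw [List.length_eraseIdx_of_lt (by simpa using hj)]; simp; omega
  refine ⟨(L.eraseIdx j).eraseIdx i, ?_, ?_⟩
  · have h1 := List.getElem_cons_eraseIdx_perm hj
    have h2 := List.getElem_cons_eraseIdx_perm hi'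
    rw [List.getElem_eraseIdx_of_lt (h' := hij)] at h2
    exact (h1.symm.trans (h2.symm.cons _)).trans (List.Perm.swap _ _ _)
  · have h2 := List.getElem_cons_eraseIdx_perm hi''
    rw [List.getElem_eraseIdx_of_lt (h' := hij)] at h2
    rw [List.getElem_set_self] at h2
    refine h2.symm.trans ?_
    rw [List.eraseIdx_set_gt hij, List.eraseIdx_set_eq]

theorem covStar_iff (a b : W) : CovStar a b ↔ Step (MS a) (MS b) := by
  constructor
  · rintro ⟨i, j, hij, hj, hle, he⟩
    rw [List.getD_eq_getElem _ _ hj, List.getD_eq_getElem _ _ (hij.trans hj)] at *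
    obtain ⟨R, h1, h2⟩ := perm_aux (LR a) i j ((LR a)[i] ++ (LR a)[j]) hij hj
    rw [← he] at h2
    exact ⟨_, _, R, Multiset.coe_eq_coe.2 h1, Multiset.coe_eq_coe.2 h2, hle⟩
  · rintro ⟨u, v, R, h1, h2, hle⟩
    have hgood := good_MS a
    have hu : u ∈ MS a := by simp [h1]
    have hv : v ∈ MS a := by simp [h1]
    obtain ⟨i, hi, ei⟩ := List.getElem_of_mem (show u ∈ LR a from hu)
    obtain ⟨j, hj, ej⟩ := List.getElem_of_mem (show v ∈ LR a from hv)
    have hne : hd u ≠ hd v := by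
      have := hgood.2
      rw [h1] at this
      simp at this
      tauto
    have hlt : hd u < hd v :=
      lt_of_le_of_ne (hle _ (hd_mem (hgood.1 u hu)) _ (hd_mem (hgood.1 v hv))) hne
    have hij : i < j := by
      rcases lt_trichotomy i j with h | h | h
      · exact h
      · subst h; rw [ei] at ej; subst ej; omega
      · have := List.pairwise_iff_getElem.1 (LR_pairwise a) j i hj hi h
        rw [ei, ej] at this; omega
    refine ⟨i, j, hij, hj, ?_, ?_⟩
    · rw [List.getD_eq_getElem _ _ hj, List.getD_eq_getElem _ _ hi, ei, ej]
      exact hle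
    · rw [List.getD_eq_getElem _ _ hj, List.getD_eq_getElem _ _ hi]
      obtain ⟨R', p1, p2⟩ := perm_aux (LR a) i j ((LR a)[i] ++ (LR a)[j]) hij hj
      have q1 := Multiset.coe_eq_coe.2 p1
      change MS a = _ at q1
      rw [h1, ← Multiset.cons_coe, ← Multiset.cons_coe, ei, ej, Multiset.cons_inj_right,
        Multiset.cons_inj_right] at q1
      have q2 : (LR b).Perm ((u ++ v) :: R') := by
        rw [← Multiset.coe_eq_coe]
        change MS b = _
        rw [h2, q1]; rfl
      rw [ei, ej] at p2 ⊢
      refine List.Perm.eq_of_pairwise (le := fun u v => hd u < hd v) ?_ (LR_pairwise b) ?_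
        (q2.trans p2.symm)
      · intro x y _ _ h1 h2; omega
      · refine List.Pairwise.sublist (List.eraseIdx_sublist _ _) ?_
        have : ((LR a).set i (u ++ v)).map hd = (LR a).map hd := by
          rw [List.map_set, hd_append (hgood.1 u hu).1, ← ei]
          apply List.ext_getElem
          · simp
          · intro n h1 h2
            rw [List.getElem_set]
            split_ifs with h
            · subst h; simp
            · rfl
        have h3 := List.pairwise_map.2 (LR_pairwise a)
        rw [← this, List.pairwise_map] at h3
        exact h3

theorem leStar_iff (a b : W) : leStar a b ↔ Le (MS a) (MS b) := by
  constructor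
  · intro h
    induction h with
    | refl => exact .refl
    | tail _ h ih => exact ih.tail ((covStar_iff _ _).1 h)
  · intro h
    generalize hN : MS b = N at h
    induction h generalizing b with
    | refl => rw [MS_inj hN]; exact .refl
    | tail h1 h ih =>
      obtain ⟨c, hc⟩ := exists_word (Le.good h1 (good_MS a))
      refine Relation.ReflTransGen.tail (ih c hc) ((covStar_iff _ _).2 ?_)
      rw [hc, hN]; exact h

theorem leStar_perm {a b : W} (h : leStar a b) : b.Perm a := by
  rw [leStar_iff] at h
  have := h.lett_eq
  rw [lett_MS, lett_MS] at this
  exact (Multiset.coe_eq_coe.1 this).symm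

theorem mem_pfFinset {n : ℕ} {b : W} : b ∈ pfFinset n ↔ IsPF b ∧ b.length = n := by
  unfold pfFinset
  rw [Finset.mem_filter, and_comm]
  refine and_congr_right fun hb => ?_
  rw [Finset.mem_image]
  constructor
  · rintro ⟨f, -, rfl⟩; simp
  · rintro rfl
    refine ⟨fun i => ⟨b[i] - 1, ?_⟩, Finset.mem_univ _, ?_⟩
    · have h1 := isPF_le hb (List.getElem_mem i.2)
      have h2 := hb.1 _ (List.getElem_mem i.2)
      simp at h1 h2 ⊢
      omega
    · apply List.ext_getElem
      · simp
      · intro i h1 h2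
        have := hb.1 _ (List.getElem_mem h2)
        simp
        omega

/-- upset -/
noncomputable def U (a : W) : Finset W := (a.permutations.toFinset).filter (fun b => leStar a b)

theorem mem_U {a b : W} : b ∈ U a ↔ Le (MS a) (MS b) := by
  rw [U, Finset.mem_filter, ← leStar_iff]
  constructor
  · exact fun h => h.2
  · intro h
    exact ⟨by simpa using leStar_perm h, h⟩

theorem U_perm {a b : W} (h : b ∈ U a) : b.Perm a := by
  rw [mem_U, ← leStar_iff] at h; exact leStar_perm h

theorem filter_eq_U {a : W} (ha : IsPF a) :
    (pfFinset a.length).filter (fun b => leStar a b) = U a := by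
  ext b
  rw [Finset.mem_filter, mem_pfFinset, mem_U, ← leStar_iff]
  constructor
  · exact fun h => h.2
  · intro h
    have := leStar_perm h
    exact ⟨⟨isPF_perm this.symm ha, this.length_eq⟩, h⟩

theorem MS_subWord (a : W) (S : Finset W) : MS (subWord a S) = (MS a).filter (· ∈ S) := by
  have h := segs_SD a
  have e : subWord a S = ((segs a).filter (· ∈ S)).flatten := by
    rw [subWord, wordOf, LR, ← List.filter_reverse, List.reverse_reverse]
  have h' : SD ((segs a).filter (· ∈ S)) :=
    ⟨fun w hw => h.1 w (List.mem_of_mem_filter hw), h.2.filter _⟩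
  rw [e, MS_of_SD h', MS_eq]
  simp

theorem subWord_sublist (a : W) (S : Finset W) : (subWord a S).Sublist a := by
  have e : subWord a S = ((segs a).filter (· ∈ S)).flatten := by
    rw [subWord, wordOf, LR, ← List.filter_reverse, List.reverse_reverse]
  have : (((segs a).filter (· ∈ S)).flatten).Sublist (segs a).flatten :=
    List.Sublist.flatten List.filter_sublist
  rwa [← e, segs_flatten] at this

theorem mem_subWord {a : W} {S : Finset W} {x : ℕ} (h : x ∈ subWord a S) : x ∈ a :=
  (subWord_sublist a S).subset h

/-- strictly monotone relabellings identify upsets -/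
theorem U_map (w : W) (F : W → W) (φ : ℕ → ℕ) (h1 : StrictMonoOn φ {x | x ∈ w})
    (h2 : ∀ s : W, s.Perm w → F s = s.map φ) {M : Type*} [AddCommMonoid M] (f : W → M) :
    ∑ x ∈ U (F w), f x = ∑ s ∈ U w, f (F s) := by
  have hw := h2 w (List.Perm.refl _)
  set ψ := Function.invFunOn φ {x | x ∈ w} with hψ
  have inv : ∀ x ∈ w, ψ (φ x) = x := fun x hx => h1.injOn.leftInvOn_invFunOn hx
  have inv' : ∀ s : W, s.Perm w → (s.map φ).map ψ = s := by
    intro s hs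
    rw [List.map_map]
    conv_rhs => rw [← List.map_id s]
    apply List.map_congr_left
    intro x hx
    exact inv x (hs.mem_iff.1 hx)
  have mono : ∀ s : W, s.Perm w → StrictMonoOn φ {x | x ∈ s} := by
    intro s hs x hx y hy
    exact h1 (hs.mem_iff.1 hx) (hs.mem_iff.1 hy)
  have mono' : StrictMonoOn ψ {x | x ∈ F w} := by
    intro x hx y hy hxy
    rw [hw] at hx hy
    obtain ⟨x, hx', rfl⟩ := List.mem_map.1 hx
    obtain ⟨y, hy', rfl⟩ := List.mem_map.1 hy
    rw [inv x hx', inv y hy']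
    exact (h1.lt_iff_lt hx' hy').1 hxy
  symm
  refine Finset.sum_nbij F ?_ ?_ ?_ (fun _ _ => rfl)
  · intro s hs
    have hp := U_perm hs
    rw [mem_U] at hs ⊢
    rw [h2 s hp, hw, MS_map h1, MS_map (mono s hp)]
    refine hs.map ?_
    rw [lett_MS]
    exact h1.monotoneOn
  · intro s hs t ht e
    have hp := U_perm hs
    have hq := U_perm ht
    rw [h2 s hp, h2 t hq] at e
    rw [← inv' s hp, ← inv' t hq, e]
  · intro x hx
    have hp := U_perm hx
    have hx' := mem_U.1 hx
    have hm : StrictMonoOn ψ {y | y ∈ x} := fun y hy z hz =>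
      mono' (hp.mem_iff.1 hy) (hp.mem_iff.1 hz)
    have hmem : x.map ψ ∈ U w := by
      rw [mem_U, MS_map hm]
      have := hx'.map (φ := ψ) (by rw [lett_MS]; exact mono'.monotoneOn)
      rw [← MS_map mono', hw, inv' w (.refl _)] at this
      exact this
    refine ⟨x.map ψ, hmem, ?_⟩
    rw [h2 _ (U_perm hmem), List.map_map]
    conv_rhs => rw [← List.map_id x]
    apply List.map_congr_left
    intro y hy
    have hy' := hp.mem_iff.1 hy
    rw [hw] at hy'
    obtain ⟨z, hz, rfl⟩ := List.mem_map.1 hy'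
    simp [inv z hz]

theorem U_Park (w : W) {M : Type*} [AddCommMonoid M] (f : W → M) :
    ∑ x ∈ U (Park w), f x = ∑ s ∈ U w, f (Park s) := by
  obtain ⟨φ, h1, h2⟩ := Park_map w
  exact U_map w Park φ h1 h2 f

end PFaux


namespace PFaux

theorem subWord_val {c : W} {T : Finset W} (h : T ⊆ (LR c).toFinset) :
    MS (subWord c T) = T.val := by
  rw [MS_subWord, ← FS_val, ← Finset.filter_val]
  congr 1
  ext w
  rw [Finset.mem_filter]
  exact ⟨fun h => h.2, fun hw => ⟨h hw, hw⟩⟩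

theorem val_add_sdiff {c : W} {T : Finset W} (h : T ⊆ (LR c).toFinset) :
    T.val + ((LR c).toFinset \ T).val = MS c := by
  rw [← FS_val, Finset.sdiff_val]
  exact add_tsub_cancel_of_le (Finset.val_le_iff.2 h)

theorem FS_inj {s t : W} (h : (LR s).toFinset = (LR t).toFinset) : s = t := by
  rw [← wordOfSet_FS s, ← wordOfSet_FS t, h]

/-- union of two words at the level of decompositions -/
noncomputable def joinW (s t : W) : W := wordOfSet (MS s + MS t).toFinset

theorem MS_joinW {s t : W} (h : Good (MS s + MS t)) : MS (joinW s t) = MS s + MS t := by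
  have e : (MS s + MS t).toFinset.val = MS s + MS t := by
    rw [Multiset.toFinset_val, Multiset.dedup_eq_self.2 h.nodup]
  rw [joinW, wordOfSet_spec, e]
  rw [e]; exact h

theorem delta_sum (a : W) {M : Type*} [AddCommMonoid M] (f : W → W → M) :
    ∑ c ∈ U a, ∑ T ∈ ((LR c).toFinset).powerset,
      f (subWord c T) (subWord c ((LR c).toFinset \ T)) =
    ∑ S ∈ ((LR a).toFinset).powerset, ∑ s ∈ U (subWord a S),
      ∑ t ∈ U (subWord a ((LR a).toFinset \ S)), f s t := by
  have hr : ∀ S : Finset W, ∑ s ∈ U (subWord a S),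
      ∑ t ∈ U (subWord a ((LR a).toFinset \ S)), f s t =
      ∑ p ∈ U (subWord a S) ×ˢ U (subWord a ((LR a).toFinset \ S)), f p.1 p.2 := by
    intro S
    rw [Finset.sum_product]
  simp only [hr]
  rw [Finset.sum_sigma', Finset.sum_sigma']
  symm
  have key : ∀ (S : Finset W) (s t : W), S ⊆ (LR a).toFinset → s ∈ U (subWord a S) →
      t ∈ U (subWord a ((LR a).toFinset \ S)) → Le (MS a) (MS s + MS t) := by
    intro S s t hS hs ht
    rw [mem_U, subWord_val hS] at hs
    rw [mem_U, subWord_val Finset.sdiff_subset] at ht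
    rw [← val_add_sdiff hS]
    exact hs.add ht
  have key2 : ∀ s t : W, Le (MS a) (MS s + MS t) →
      MS (joinW s t) = MS s + MS t ∧ (LR s).toFinset ⊆ (LR (joinW s t)).toFinset ∧
      subWord (joinW s t) (LR s).toFinset = s ∧
      subWord (joinW s t) ((LR (joinW s t)).toFinset \ (LR s).toFinset) = t := by
    intro s t h
    have e := MS_joinW (h.good (good_MS a))
    have hsub : (LR s).toFinset ⊆ (LR (joinW s t)).toFinset := by
      intro w hw
      rw [mem_FS] at hw ⊢
      rw [e]; simp [hw]
    refine ⟨e, hsub, ?_, ?_⟩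
    · apply MS_inj
      rw [subWord_val hsub, FS_val]
    · apply MS_inj
      rw [subWord_val Finset.sdiff_subset]
      have := val_add_sdiff hsub
      rw [e, FS_val] at this
      exact add_left_cancel this
  refine Finset.sum_nbij (fun x => ⟨joinW x.2.1 x.2.2, (LR x.2.1).toFinset⟩) ?_ ?_ ?_ ?_
  · rintro ⟨S, s, t⟩ h
    simp only [Finset.mem_sigma, Finset.mem_powerset, Finset.mem_product] at h ⊢
    have hk := key S s t h.1 h.2.1 h.2.2
    obtain ⟨e, h1, -, -⟩ := key2 s t hk
    exact ⟨by rw [mem_U, e]; exact hk, h1⟩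
  · rintro ⟨S, s, t⟩ h ⟨S', s', t'⟩ h' he
    simp only [Finset.coe_sigma, Set.mem_sigma_iff, Finset.mem_coe, Finset.mem_powerset,
      Finset.mem_product] at h h'
    simp only [Sigma.mk.injEq, heq_eq_eq] at he
    obtain ⟨he1, he2⟩ := he
    obtain ⟨-, -, -, h4⟩ := key2 s t (key S s t h.1 h.2.1 h.2.2)
    obtain ⟨-, -, -, h4'⟩ := key2 s' t' (key S' s' t' h'.1 h'.2.1 h'.2.2)
    have es := FS_inj he2
    have et : t = t' := by rw [← h4, ← h4', he1, he2]
    subst es et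
    have : S = S' := by
      have l1 := (mem_U.1 h.2.1).lett_eq
      have l2 := (mem_U.1 h'.2.1).lett_eq
      rw [subWord_val h.1] at l1
      rw [subWord_val h'.1] at l2
      apply Finset.val_injective
      refine lett_inj (good_MS a) ?_ ?_ (l1.trans l2.symm)
      · rw [← FS_val]; exact Finset.val_le_iff.2 h.1
      · rw [← FS_val]; exact Finset.val_le_iff.2 h'.1
    subst this
    rfl
  · rintro ⟨c, T⟩ h
    simp only [Finset.coe_sigma, Set.mem_sigma_iff, Finset.mem_coe, Finset.mem_powerset] at h
    obtain ⟨hc, hT⟩ := h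
    have hc' := mem_U.1 hc
    rw [← val_add_sdiff hT] at hc'
    obtain ⟨S1, S2, e, l1, l2⟩ := hc'.split
    have hle : S1 ≤ MS a := by rw [e]; exact Multiset.le_add_right _ _
    let S : Finset W := ⟨S1, ((good_MS a).mono hle).nodup⟩
    have hS : S ⊆ (LR a).toFinset := by
      rw [← Finset.val_le_iff, FS_val]; exact hle
    have hS2 : ((LR a).toFinset \ S).val = S2 := by
      have := val_add_sdiff hS
      rw [e] at this
      exact add_left_cancel this
    have m1 : MS (subWord c T) = T.val := subWord_val hT
    have m2 : MS (subWord c ((LR c).toFinset \ T)) = ((LR c).toFinset \ T).val :=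
      subWord_val Finset.sdiff_subset
    have u1 : subWord c T ∈ U (subWord a S) := by
      rw [mem_U, m1, subWord_val hS]; exact l1
    have u2 : subWord c ((LR c).toFinset \ T) ∈ U (subWord a ((LR a).toFinset \ S)) := by
      rw [mem_U, m2, subWord_val Finset.sdiff_subset, hS2]; exact l2
    refine ⟨⟨S, subWord c T, subWord c ((LR c).toFinset \ T)⟩, ?_, ?_⟩
    · simp only [Finset.coe_sigma, Set.mem_sigma_iff, Finset.mem_coe, Finset.mem_powerset,
        Finset.mem_product]
      exact ⟨hS, u1, u2⟩
    · obtain ⟨e1, -, -, -⟩ := key2 _ _ (key _ _ _ hS u1 u2)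
      have ec : joinW (subWord c T) (subWord c ((LR c).toFinset \ T)) = c := by
        apply MS_inj
        rw [e1, m1, m2, val_add_sdiff hT]
      have eT : (LR (subWord c T)).toFinset = T := by
        apply Finset.val_injective
        rw [FS_val, m1]
      simp only [ec, eT]
  · rintro ⟨S, s, t⟩ h
    simp only [Finset.mem_sigma, Finset.mem_powerset, Finset.mem_product] at h
    obtain ⟨-, -, h3, h4⟩ := key2 s t (key S s t h.1 h.2.1 h.2.2)
    simp only [h3, h4]

theorem starF_eq (K : Type) [Field K] (x y : FW K) : starF K x y =
    Finsupp.linearCombination K (fun a => Finsupp.linearCombination K (mulSingle K a) y) x := by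
  simp only [starF, Finsupp.linearCombination_apply, Finsupp.smul_sum, mul_smul]

theorem deltaF_eq (K : Type) [Field K] (x : FW K) : deltaF K x =
    Finsupp.linearCombination K (deltaSingle K) x := by
  simp only [deltaF, Finsupp.linearCombination_apply]

theorem star_closed (K : Type) [Field K] (G : Set (FW K))
    (h : ∀ x ∈ G, ∀ y ∈ G, starF K x y ∈ Submodule.span K G) (x y : FW K)
    (hx : x ∈ Submodule.span K G) (hy : y ∈ Submodule.span K G) :
    starF K x y ∈ Submodule.span K G := by
  induction hx using Submodule.span_induction with
  | mem x hx =>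
    have e : ∀ z, starF K x z =
        (x.sum fun a c => c • Finsupp.linearCombination K (mulSingle K a) z) := by
      intro z; rw [starF_eq, Finsupp.linearCombination_apply]
    induction hy using Submodule.span_induction with
    | mem y hy => exact h x hx y hy
    | zero => rw [e]; simp
    | add y z _ _ h1 h2 =>
      rw [e] at h1 h2 ⊢
      simp only [map_add, smul_add, Finsupp.sum_add]
      exact add_mem h1 h2
    | smul c y _ h1 =>
      rw [e] at h1 ⊢
      simp only [map_smul, smul_comm _ c, ← Finsupp.smul_sum]
      exact Submodule.smul_mem _ _ h1
  | zero => rw [starF_eq]; simp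
  | add x z _ _ h1 h2 =>
    rw [starF_eq] at h1 h2 ⊢
    rw [map_add]; exact add_mem h1 h2
  | smul c x _ h1 =>
    rw [starF_eq] at h1 ⊢
    rw [map_smul]; exact Submodule.smul_mem _ _ h1

theorem delta_closed (K : Type) [Field K] (G : Set (FW K)) (H : Set (FW2 K))
    (h : ∀ x ∈ G, deltaF K x ∈ Submodule.span K H) (x : FW K)
    (hx : x ∈ Submodule.span K G) : deltaF K x ∈ Submodule.span K H := by
  induction hx using Submodule.span_induction with
  | mem x hx => exact h x hx
  | zero => rw [deltaF_eq]; simp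
  | add x z _ _ h1 h2 =>
    rw [deltaF_eq] at h1 h2 ⊢
    rw [map_add]; exact add_mem h1 h2
  | smul c x _ h1 =>
    rw [deltaF_eq] at h1 ⊢
    rw [map_smul]; exact Submodule.smul_mem _ _ h1

theorem star_Mb (K : Type) [Field K] (a b : W) : starF K (Mb K a) (Mb K b) = mulSingle K a b := by
  simp [starF_eq, Mb]

theorem delta_Mb (K : Type) [Field K] (a : W) : deltaF K (Mb K a) = deltaSingle K a := by
  simp [deltaF_eq, Mb]

theorem M_star (K : Type) [Field K] (P : W → Prop) (hP : MulClosed P) (x y : FW K)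
    (hx : x ∈ spanM K P) (hy : y ∈ spanM K P) : starF K x y ∈ spanM K P := by
  refine star_closed K _ ?_ x y hx hy
  rintro _ ⟨a, ha, pa, rfl⟩ _ ⟨b, hb, pb, rfl⟩
  rw [star_Mb, mulSingle]
  refine Submodule.sum_mem _ fun Θ hΘ => Submodule.subset_span ?_
  have := hP a b ha hb pa pb Θ hΘ
  exact ⟨_, this.1, this.2.1, rfl⟩

theorem M_delta (K : Type) [Field K] (P : W → Prop) (hP : ParkClosed P) (x : FW K)
    (hx : x ∈ spanM K P) : deltaF K x ∈ spanM2 K P := by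
  refine delta_closed K _ _ ?_ x hx
  rintro _ ⟨a, ha, pa, rfl⟩
  rw [delta_Mb, deltaSingle]
  refine Submodule.sum_mem _ fun S hS => Submodule.subset_span ?_
  have h1 := hP a ha pa S hS
  have h2 := hP a ha pa (((LR a).toFinset) \ S) (by simp)
  exact ⟨_, h1.1, h1.2.1, h2.1, h2.2.1, rfl⟩

theorem delta_Qb (K : Type) [Field K] {a : W} (ha : IsPF a) : deltaF K (Qb K a) =
    ∑ S ∈ ((LR a).toFinset).powerset,
      QT K (Park (subWord a S)) (Park (subWord a ((LR a).toFinset \ S))) := by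
  rw [Qb, filter_eq_U ha, deltaF_eq, map_sum]
  simp only [← deltaF_eq, delta_Mb, deltaSingle]
  rw [delta_sum a (fun s t => Finsupp.single (Park s, Park t) (1 : K))]
  refine Finset.sum_congr rfl fun S _ => ?_
  have hp : ∀ S, IsPF (Park (subWord a S)) := fun S =>
    Park_isPF _ fun x hx => ha.1 x (mem_subWord hx)
  rw [QT, filter_eq_U (hp _), filter_eq_U (hp _),
    U_Park _ (fun b => ∑ c ∈ U (Park (subWord a ((LR a).toFinset \ S))),
      Finsupp.single (b, c) (1 : K))]
  refine Finset.sum_congr rfl fun s _ => ?_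
  rw [U_Park _ (fun c => Finsupp.single (Park s, c) (1 : K))]

theorem Q_delta (K : Type) [Field K] (P : W → Prop) (hP : ParkClosed P) (x : FW K)
    (hx : x ∈ spanQ K P) : deltaF K x ∈ spanQ2 K P := by
  refine delta_closed K _ _ ?_ x hx
  rintro _ ⟨a, ha, pa, rfl⟩
  rw [delta_Qb K ha]
  refine Submodule.sum_mem _ fun S hS => Submodule.subset_span ?_
  have h1 := hP a ha pa S hS
  have h2 := hP a ha pa (((LR a).toFinset) \ S) (by simp)
  exact ⟨(_, _), h1.1, h1.2.1, h2.1, h2.2.1, rfl⟩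

theorem park_closed_of (P : W → Prop)
    (h : ∀ (a : W), IsPF a → P a → ∀ S ⊆ (LR a).toFinset, ∀ φ : ℕ → ℕ,
      StrictMonoOn φ {x | x ∈ subWord a S} → IsPF ((subWord a S).map φ) → P ((subWord a S).map φ)) :
    ParkClosed P := by
  intro a ha pa S hS
  have hp : IsPF (Park (subWord a S)) := Park_isPF _ fun x hx => ha.1 x (mem_subWord hx)
  obtain ⟨φ, h1, h2⟩ := Park_map (subWord a S)
  rw [h2 _ (.refl _)] at hp ⊢
  exact ⟨hp, h a ha pa S (Finset.mem_powerset.1 hS) φ h1 hp, by simp⟩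

theorem park_N : ParkClosed Nprop := by
  apply park_closed_of
  intro a ha pa S hS φ hφ _ w hw
  change w ∈ MS _ at hw
  rw [MS_map hφ, subWord_val hS] at hw
  obtain ⟨u, hu, rfl⟩ := Multiset.mem_map.1 hw
  have hu' : u ∈ LR a := by simpa using hS hu
  have := pa u hu'
  change List.IsChain _ _ at this
  change List.IsChain _ _
  rw [List.isChain_iff_pairwise] at this ⊢
  rw [List.pairwise_map]
  refine this.imp_of_mem ?_
  intro x y hx hy hxy
  have hm : ∀ z ∈ u, z ∈ subWord a S := fun z hz =>
    mem_of_MS (w := u) (by rw [subWord_val hS]; exact hu) hz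
  exact hφ.monotoneOn (hm x hx) (hm y hy) hxy

theorem Dprop_iff (a : W) : Dprop a ↔ ∀ u ∈ MS a, ∀ v ∈ MS a, u ≠ v → ∀ x ∈ u, x ∉ v := by
  have hs : Std.Symm (fun u v : W => ∀ x ∈ u, x ∉ v) := ⟨fun u v h x hx hx' => h x hx' hx⟩
  have hn : (LR a).Nodup := by
    have := (good_MS a).nodup
    rwa [MS, Multiset.coe_nodup] at this
  unfold Dprop
  constructor
  · intro h u hu v hv huv
    exact h.forall hu hv huv
  · intro h
    refine hn.imp_of_mem ?_
    intro u v hu hv huv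
    exact h u hu v hv huv

theorem park_D : ParkClosed Dprop := by
  apply park_closed_of
  intro a ha pa S hS φ hφ _
  rw [Dprop_iff] at pa ⊢
  rw [MS_map hφ, subWord_val hS]
  intro u hu v hv huv x hx hx'
  obtain ⟨u, hu', rfl⟩ := Multiset.mem_map.1 hu
  obtain ⟨v, hv', rfl⟩ := Multiset.mem_map.1 hv
  obtain ⟨y, hy, rfl⟩ := List.mem_map.1 hx
  obtain ⟨z, hz, e⟩ := List.mem_map.1 hx'
  have hm : ∀ u ∈ S.val, ∀ z ∈ u, z ∈ subWord a S := fun u hu z hz =>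
    mem_of_MS (w := u) (by rw [subWord_val hS]; exact hu) hz
  have : z = y := hφ.injOn (hm v hv' z hz) (hm u hu' y hy) e
  subst this
  refine pa u (mem_FS.1 (hS hu')) v (mem_FS.1 (hS hv')) ?_ z hy hz
  rintro rfl; exact huv rfl

theorem Sprop_of {a : W} (ha : IsPF a) (hn : a.Nodup) : Sprop a := by
  unfold Sprop
  refine (List.subperm_of_subset hn ?_).perm_of_length_le (by simp)
  intro x hx
  have h1 := isPF_le ha hx
  have h2 := ha.1 x hx
  rw [List.mem_range'_1]
  omega

theorem Sprop_nodup {a : W} (h : Sprop a) : a.Nodup := h.nodup_iff.2 List.nodup_range'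

theorem park_S : ParkClosed Sprop := by
  apply park_closed_of
  intro a ha pa S hS φ hφ hp
  refine Sprop_of hp ?_
  refine List.Nodup.map_on ?_ ((Sprop_nodup pa).sublist (subWord_sublist a S))
  intro x hx y hy e
  exact hφ.injOn hx hy e

theorem NonInc_iff (a : W) : NonInc a ↔ a.Pairwise (fun x y => y ≤ x) := by
  unfold NonInc
  change List.IsChain _ _ ↔ _
  have : IsTrans ℕ (fun x y => y ≤ x) := ⟨fun a b c h1 h2 => le_trans h2 h1⟩
  exact List.isChain_iff_pairwise

theorem park_C : ParkClosed NonInc := by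
  apply park_closed_of
  intro a ha pa S hS φ hφ hp
  rw [NonInc_iff] at pa ⊢
  rw [List.pairwise_map]
  refine (pa.sublist (subWord_sublist a S)).imp_of_mem ?_
  intro x y hx hy h
  exact hφ.monotoneOn hy hx h

theorem slash_perm (a b : W) : (slashProd a b).Perm (a ++ shiftW a.length b) :=
  List.perm_append_comm

theorem slash_C (a b : W) (ha : IsPF a) (hb : IsPF b) (pa : NonInc a) (pb : NonInc b) :
    IsPF (slashProd a b) ∧ NonInc (slashProd a b) ∧
          (slashProd a b).length = a.length + b.length := by
  refine ⟨isPF_perm (slash_perm a b).symm (isPF_append ha hb), ?_, ?_⟩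
  · rw [NonInc_iff] at *
    rw [slashProd, List.pairwise_append]
    refine ⟨?_, pa, ?_⟩
    · rw [shiftW, List.pairwise_map]
      exact pb.imp (fun h => by omega)
    · intro x hx y hy
      obtain ⟨z, hz, rfl⟩ := List.mem_map.1 hx
      have := isPF_le ha hy
      omega
  · simp [slashProd, shiftW]; omega

end PFaux


namespace PFaux

/-- small letters -/
def lo (m : ℕ) (w : W) : W := w.filter (fun x => decide (x ≤ m))
/-- large letters -/
def hi (m : ℕ) (w : W) : W := w.filter (fun x => decide (m < x))

theorem lo_append (m : ℕ) (u v : W) : lo m (u ++ v) = lo m u ++ lo m v := by simp [lo]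
theorem hi_append (m : ℕ) (u v : W) : hi m (u ++ v) = hi m u ++ hi m v := by simp [hi]

theorem lo_self {m : ℕ} {u : W} (h : ∀ x ∈ u, x ≤ m) : lo m u = u := by
  rw [lo, List.filter_eq_self]; simpa using h
theorem hi_self {m : ℕ} {u : W} (h : ∀ x ∈ u, m < x) : hi m u = u := by
  rw [hi, List.filter_eq_self]; simpa using h
theorem lo_nil {m : ℕ} {u : W} (h : ∀ x ∈ u, m < x) : lo m u = [] := by
  rw [lo, List.filter_eq_nil_iff]; simpa using h
theorem hi_nil {m : ℕ} {u : W} (h : ∀ x ∈ u, x ≤ m) : hi m u = [] := by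
  rw [hi, List.filter_eq_nil_iff]; simpa using h
theorem mem_lo {m x : ℕ} {u : W} : x ∈ lo m u ↔ x ∈ u ∧ x ≤ m := by simp [lo]
theorem mem_hi {m x : ℕ} {u : W} : x ∈ hi m u ↔ x ∈ u ∧ m < x := by simp [hi]

/-- nonempty images of words under a map -/
noncomputable def Res (f : W → W) (M : Multiset W) : Multiset W :=
  (M.filter (fun w => f w ≠ [])).map f

theorem Res_cons (f : W → W) (w : W) (M : Multiset W) :
    Res f (w ::ₘ M) = if f w = [] then Res f M else f w ::ₘ Res f M := by
  unfold Res
  split_ifs with h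
  · rw [Multiset.filter_cons_of_neg _ (by simpa using h)]
  · rw [Multiset.filter_cons_of_pos _ (by simpa using h), Multiset.map_cons]

theorem Res_add (f : W → W) (M N : Multiset W) : Res f (M + N) = Res f M + Res f N := by
  simp [Res]

theorem Res_self (f : W → W) (M : Multiset W) (h : ∀ w ∈ M, f w = w ∧ w ≠ []) : Res f M = M := by
  unfold Res
  rw [Multiset.filter_eq_self.2 (fun w hw => by rw [(h w hw).1]; exact (h w hw).2)]
  conv_rhs => rw [← Multiset.map_id M]
  exact Multiset.map_congr rfl (fun w hw => (h w hw).1)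

theorem Res_zero (f : W → W) (M : Multiset W) (h : ∀ w ∈ M, f w = []) : Res f M = 0 := by
  unfold Res
  rw [Multiset.filter_eq_nil.2 (fun w hw => by simp [h w hw])]
  rfl

theorem Res_map (f : W → W) (Θ : Multiset (W × W)) (g k : W × W → W)
    (h : ∀ p ∈ Θ, f (g p) = k p ∧ k p ≠ []) : Res f (Θ.map g) = Θ.map k := by
  unfold Res
  rw [Multiset.filter_eq_self.2, Multiset.map_map]
  · exact Multiset.map_congr rfl (fun p hp => (h p hp).1)
  · intro w hw
    obtain ⟨p, hp, rfl⟩ := Multiset.mem_map.1 hw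
    rw [(h p hp).1]; exact (h p hp).2

theorem mem_Res {f : W → W} {M : Multiset W} {u : W} :
    u ∈ Res f M ↔ u ≠ [] ∧ ∃ w ∈ M, f w = u := by
  unfold Res
  rw [Multiset.mem_map]
  constructor
  · rintro ⟨w, hw, rfl⟩
    rw [Multiset.mem_filter] at hw
    exact ⟨hw.2, w, hw.1, rfl⟩
  · rintro ⟨h, w, hw, rfl⟩
    exact ⟨w, Multiset.mem_filter.2 ⟨hw, h⟩, rfl⟩

theorem Res_inj {f : W → W} {M : Multiset W} (h : Good (Res f M)) {u v : W} (hu : u ∈ M)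
    (hv : v ∈ M) (hne : f u ≠ []) (e : f u = f v) : u = v := by
  refine Multiset.inj_on_of_nodup_map h.nodup u ?_ v ?_ e
  · exact Multiset.mem_filter.2 ⟨hu, hne⟩
  · exact Multiset.mem_filter.2 ⟨hv, e ▸ hne⟩

theorem Step.res {f : W → W} (hf : ∀ u v, f (u ++ v) = f u ++ f v) (hs : ∀ u, ∀ x ∈ f u, x ∈ u)
    {M N : Multiset W} (h : Step M N) : Le (Res f M) (Res f N) := by
  obtain ⟨u, v, R, rfl, rfl, huv⟩ := h
  simp only [Res_cons, hf]
  by_cases h1 : f u = []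
  · by_cases h2 : f v = []
    · simp only [h1, h2, List.append_nil, if_true]; exact .refl
    · simp only [h1, h2, List.nil_append, if_true, if_false]; exact .refl
  · by_cases h2 : f v = []
    · simp only [h1, h2, List.append_nil, if_true, if_false]; exact .refl
    · have h3 : ¬ (f u ++ f v = []) := by simp [h1]
      simp only [h1, h2, h3, if_false]
      exact .single ⟨_, _, _, rfl, rfl, fun x hx y hy => huv x (hs u x hx) y (hs v y hy)⟩

theorem Le.res {f : W → W} (hf : ∀ u v, f (u ++ v) = f u ++ f v) (hs : ∀ u, ∀ x ∈ f u, x ∈ u)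
    {M N : Multiset W} (h : Le M N) : Le (Res f M) (Res f N) := by
  induction h with
  | refl => exact .refl
  | tail _ h ih => exact Relation.ReflTransGen.trans ih (h.res hf hs)

theorem Le.lo {M N : Multiset W} (h : Le M N) (m : ℕ) : Le (Res (lo m) M) (Res (lo m) N) :=
  h.res (lo_append m) (fun _ _ hx => (mem_lo.1 hx).1)

theorem Le.hi {M N : Multiset W} (h : Le M N) (m : ℕ) : Le (Res (hi m) M) (Res (hi m) N) :=
  h.res (hi_append m) (fun _ _ hx => (mem_hi.1 hx).1)

/-- small letters come first -/
def Spl (m : ℕ) (w : W) : Prop := lo m w ++ hi m w = w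

theorem Spl_append {m : ℕ} {u v : W} (hu : Spl m u) (hv : Spl m v)
    (h : ∀ x ∈ u, ∀ y ∈ v, x ≤ y) : Spl m (u ++ v) := by
  unfold Spl at *
  rw [lo_append, hi_append]
  have : lo m v ++ hi m u = hi m u ++ lo m v := by
    cases h1 : hi m u with
    | nil => simp
    | cons x xs =>
      cases h2 : lo m v with
      | nil => simp
      | cons y ys =>
        have hx := mem_hi.1 (show x ∈ hi m u by simp [h1])
        have hy := mem_lo.1 (show y ∈ lo m v by simp [h2])
        have := h x hx.1 y hy.1
        omega
  calc lo m u ++ lo m v ++ (hi m u ++ hi m v)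
      = lo m u ++ (lo m v ++ hi m u) ++ hi m v := by simp
    _ = (lo m u ++ hi m u) ++ (lo m v ++ hi m v) := by rw [this]; simp
    _ = u ++ v := by rw [hu, hv]

theorem Le.spl {M N : Multiset W} {m : ℕ} (h : Le M N) (hM : ∀ w ∈ M, Spl m w) :
    ∀ w ∈ N, Spl m w := by
  induction h with
  | refl => exact hM
  | tail _ h ih =>
    obtain ⟨u, v, R, rfl, rfl, huv⟩ := h
    intro w hw
    rcases Multiset.mem_cons.1 hw with rfl | hw
    · exact Spl_append (ih u (by simp)) (ih v (by simp)) huv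
    · exact ih w (by simp [hw])

/-- small and large good sets -/
structure LH (m : ℕ) (X Y : Finset W) : Prop where
  gx : Good X.val
  gy : Good Y.val
  lx : ∀ u ∈ X, ∀ x ∈ u, x ≤ m
  ly : ∀ u ∈ Y, ∀ x ∈ u, m < x

/-- matchings -/
noncomputable def Mt (X Y : Finset W) : Finset (Finset (W × W)) :=
  (X ×ˢ Y).powerset.filter
    (fun Θ => ∀ p ∈ Θ, ∀ q ∈ Θ, (p.1 = q.1 ∨ p.2 = q.2) → p = q)

theorem mem_Mt {X Y : Finset W} {Θ : Finset (W × W)} : Θ ∈ Mt X Y ↔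
    (∀ p ∈ Θ, p.1 ∈ X ∧ p.2 ∈ Y) ∧
      ∀ p ∈ Θ, ∀ q ∈ Θ, (p.1 = q.1 ∨ p.2 = q.2) → p = q := by
  rw [Mt, Finset.mem_filter, Finset.mem_powerset]
  refine and_congr_left fun _ => ?_
  constructor
  · intro h p hp; exact Finset.mem_product.1 (h hp)
  · intro h p hp; exact Finset.mem_product.2 (h p hp)

theorem LH.good_add {m : ℕ} {X Y : Finset W} (h : LH m X Y) : Good (X.val + Y.val) := by
  refine ⟨?_, ?_⟩
  · intro w hw
    rcases Multiset.mem_add.1 hw with hw | hw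
    · exact h.gx.1 w hw
    · exact h.gy.1 w hw
  · rw [Multiset.map_add, Multiset.nodup_add]
    refine ⟨h.gx.2, h.gy.2, ?_⟩
    rw [Multiset.disjoint_left]
    intro x hx hy
    obtain ⟨u, hu, rfl⟩ := Multiset.mem_map.1 hx
    obtain ⟨v, hv, e⟩ := Multiset.mem_map.1 hy
    have h1 := h.lx u hu _ (hd_mem (h.gx.1 u hu))
    have h2 := h.ly v hv _ (hd_mem (h.gy.1 v hv))
    omega

theorem val_eq {X : Finset W} {Θ : Finset (W × W)} (g : W × W → W)
    (h1 : ∀ p ∈ Θ, g p ∈ X) (h2 : ∀ p ∈ Θ, ∀ q ∈ Θ, g p = g q → p = q) :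
    X.val = Θ.val.map g + (X.filter (fun u => ∀ p ∈ Θ, g p ≠ u)).val := by
  refine (Multiset.Nodup.ext X.nodup ?_).2 ?_
  · rw [Multiset.nodup_add]
    refine ⟨Multiset.Nodup.map_on (fun p hp q hq e => h2 p hp q hq e) Θ.nodup,
      Finset.nodup _, ?_⟩
    rw [Multiset.disjoint_left]
    intro u hu hu'
    obtain ⟨p, hp, rfl⟩ := Multiset.mem_map.1 hu
    exact (Finset.mem_filter.1 hu').2 p hp rfl
  · intro u
    rw [Multiset.mem_add, Multiset.mem_map]
    constructor
    · intro hu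
      by_cases hc : ∃ p ∈ Θ, g p = u
      · exact Or.inl hc
      · push Not at hc
        exact Or.inr (Finset.mem_filter.2 ⟨hu, hc⟩)
    · rintro (⟨p, hp, rfl⟩ | hu)
      · exact h1 p hp
      · exact (Finset.mem_filter.1 hu).1

theorem Le_pairs (Θ : Multiset (W × W)) (h : ∀ p ∈ Θ, ∀ x ∈ p.1, ∀ y ∈ p.2, x ≤ y) :
    Le (Θ.map Prod.fst + Θ.map Prod.snd) (Θ.map (fun p => p.1 ++ p.2)) := by
  induction Θ using Multiset.induction_on with
  | empty => exact .refl
  | cons p Θ ih =>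
    have h1 := ih (fun q hq => h q (by simp [hq]))
    have h2 : Step (p.1 ::ₘ p.2 ::ₘ 0) ((p.1 ++ p.2) ::ₘ 0) :=
      ⟨_, _, _, rfl, rfl, h p (by simp)⟩
    have h3 := Le.add (Relation.ReflTransGen.single h2) h1
    simp only [Multiset.map_cons, Multiset.cons_add, Multiset.add_cons, zero_add] at h3 ⊢
    rw [Multiset.cons_swap] at h3
    exact h3

theorem glue_val {m : ℕ} {X Y : Finset W} (h : LH m X Y) {Θ : Finset (W × W)} (hΘ : Θ ∈ Mt X Y) :
    (glueSet X Y Θ).val = Θ.val.map (fun p => p.1 ++ p.2) +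
      (X.filter (fun u => ∀ p ∈ Θ, p.1 ≠ u)).val + (Y.filter (fun u => ∀ p ∈ Θ, p.2 ≠ u)).val ∧
    Le (X.val + Y.val) (glueSet X Y Θ).val := by
  rw [mem_Mt] at hΘ
  have hX := val_eq (X := X) (Θ := Θ) Prod.fst (fun p hp => (hΘ.1 p hp).1)
    (fun p hp q hq e => hΘ.2 p hp q hq (Or.inl e))
  have hY := val_eq (X := Y) (Θ := Θ) Prod.snd (fun p hp => (hΘ.1 p hp).2)
    (fun p hp q hq e => hΘ.2 p hp q hq (Or.inr e))
  have hle : Le (X.val + Y.val) (Θ.val.map (fun p => p.1 ++ p.2) +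
      (X.filter (fun u => ∀ p ∈ Θ, p.1 ≠ u)).val +
      (Y.filter (fun u => ∀ p ∈ Θ, p.2 ≠ u)).val) := by
    have h1 := Le_pairs Θ.val (fun p hp x hx y hy =>
      ((h.lx p.1 (hΘ.1 p hp).1 x hx).trans (h.ly p.2 (hΘ.1 p hp).2 y hy).le))
    have h2 := (h1.add_right (X.filter (fun u => ∀ p ∈ Θ, p.1 ≠ u)).val).add_right
      (Y.filter (fun u => ∀ p ∈ Θ, p.2 ≠ u)).val
    convert h2 using 1
    conv_lhs => rw [hX, hY]
    abel
  have e : (glueSet X Y Θ).val = Θ.val.map (fun p => p.1 ++ p.2) +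
      (X.filter (fun u => ∀ p ∈ Θ, p.1 ≠ u)).val +
      (Y.filter (fun u => ∀ p ∈ Θ, p.2 ≠ u)).val := by
    refine (Multiset.Nodup.ext (Finset.nodup _) (hle.good h.good_add).nodup).2 ?_
    intro w
    rw [Finset.mem_val, glueSet, Finset.mem_union, Finset.mem_union, Multiset.mem_add,
      Multiset.mem_add, Finset.mem_image, Multiset.mem_map]
    rfl
  exact ⟨e, e ▸ hle⟩

theorem glue_good {m : ℕ} {X Y : Finset W} (h : LH m X Y) {Θ : Finset (W × W)} (hΘ : Θ ∈ Mt X Y) :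
    Good (glueSet X Y Θ).val := (glue_val h hΘ).2.good h.good_add

theorem glue_lo {m : ℕ} {X Y : Finset W} (h : LH m X Y) {Θ : Finset (W × W)} (hΘ : Θ ∈ Mt X Y) :
    Res (lo m) (glueSet X Y Θ).val = X.val := by
  rw [(glue_val h hΘ).1]
  rw [mem_Mt] at hΘ
  have hX := val_eq (X := X) (Θ := Θ) Prod.fst (fun p hp => (hΘ.1 p hp).1)
    (fun p hp q hq e => hΘ.2 p hp q hq (Or.inl e))
  rw [Res_add, Res_add, Res_map (lo m) Θ.val _ Prod.fst, Res_self, Res_zero (lo m), add_zero]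
  · exact hX.symm
  · intro w hw
    exact lo_nil (h.ly w (Finset.mem_filter.1 hw).1)
  · intro w hw
    have := (Finset.mem_filter.1 hw).1
    exact ⟨lo_self (h.lx w this), (h.gx.1 w this).1⟩
  · intro p hp
    obtain ⟨h1, h2⟩ := hΘ.1 p hp
    rw [lo_append, lo_self (h.lx _ h1), lo_nil (h.ly _ h2), List.append_nil]
    exact ⟨rfl, (h.gx.1 _ h1).1⟩

theorem glue_hi {m : ℕ} {X Y : Finset W} (h : LH m X Y) {Θ : Finset (W × W)} (hΘ : Θ ∈ Mt X Y) :
    Res (hi m) (glueSet X Y Θ).val = Y.val := by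
  rw [(glue_val h hΘ).1]
  rw [mem_Mt] at hΘ
  have hY := val_eq (X := Y) (Θ := Θ) Prod.snd (fun p hp => (hΘ.1 p hp).2)
    (fun p hp q hq e => hΘ.2 p hp q hq (Or.inr e))
  rw [Res_add, Res_add, Res_map (hi m) Θ.val _ Prod.snd,
    Res_zero (hi m) (X.filter _).val, Res_self, add_zero]
  · exact hY.symm
  · intro w hw
    have := (Finset.mem_filter.1 hw).1
    exact ⟨hi_self (h.ly w this), (h.gy.1 w this).1⟩
  · intro w hw
    exact hi_nil (h.lx w (Finset.mem_filter.1 hw).1)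
  · intro p hp
    obtain ⟨h1, h2⟩ := hΘ.1 p hp
    rw [hi_append, hi_nil (h.lx _ h1), hi_self (h.ly _ h2), List.nil_append]
    exact ⟨rfl, (h.gy.1 _ h2).1⟩

theorem mem_Theta {m : ℕ} {X Y : Finset W} (h : LH m X Y) {Θ : Finset (W × W)}
    (hΘ : Θ ∈ Mt X Y) (p : W × W) : p ∈ Θ ↔
      ∃ w ∈ glueSet X Y Θ, lo m w ≠ [] ∧ hi m w ≠ [] ∧ p = (lo m w, hi m w) := by
  rw [mem_Mt] at hΘ
  have hp1 : ∀ p ∈ Θ, lo m (p.1 ++ p.2) = p.1 ∧ hi m (p.1 ++ p.2) = p.2 := by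
    intro p hp
    obtain ⟨h1, h2⟩ := hΘ.1 p hp
    rw [hi_append, hi_nil (h.lx _ h1), hi_self (h.ly _ h2), List.nil_append,
      lo_append, lo_self (h.lx _ h1), lo_nil (h.ly _ h2), List.append_nil]
    exact ⟨rfl, rfl⟩
  constructor
  · intro hp
    refine ⟨p.1 ++ p.2, ?_, ?_⟩
    · simp only [glueSet, Finset.mem_union, Finset.mem_image]
      exact Or.inl (Or.inl ⟨p, hp, rfl⟩)
    · rw [(hp1 p hp).1, (hp1 p hp).2]
      exact ⟨(h.gx.1 _ (hΘ.1 p hp).1).1, (h.gy.1 _ (hΘ.1 p hp).2).1, rfl⟩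
  · rintro ⟨w, hw, h1, h2, rfl⟩
    simp only [glueSet, Finset.mem_union, Finset.mem_image, Finset.mem_filter] at hw
    rcases hw with (⟨q, hq, rfl⟩ | hw) | hw
    · rw [(hp1 q hq).1, (hp1 q hq).2]; exact hq
    · exact absurd (hi_nil (h.lx w hw.1)) h2
    · exact absurd (lo_nil (h.ly w hw.1)) h1

/-- recovered matching -/
noncomputable def recT (m : ℕ) (G : Finset W) : Finset (W × W) :=
  (G.filter (fun w => lo m w ≠ [] ∧ hi m w ≠ [])).image (fun w => (lo m w, hi m w))

theorem mem_recT {m : ℕ} {G : Finset W} {p : W × W} : p ∈ recT m G ↔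
    ∃ w ∈ G, lo m w ≠ [] ∧ hi m w ≠ [] ∧ p = (lo m w, hi m w) := by
  simp only [recT, Finset.mem_image, Finset.mem_filter]
  constructor
  · rintro ⟨w, ⟨h1, h2, h3⟩, rfl⟩; exact ⟨w, h1, h2, h3, rfl⟩
  · rintro ⟨w, h1, h2, h3, rfl⟩; exact ⟨w, ⟨h1, h2, h3⟩, rfl⟩

theorem rec_glue {m : ℕ} {X Y G : Finset W} (h : LH m X Y) (hG : Good G.val)
    (hs : ∀ w ∈ G, Spl m w) (h1 : X.val = Res (lo m) G.val) (h2 : Y.val = Res (hi m) G.val) :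
    recT m G ∈ Mt X Y ∧ glueSet X Y (recT m G) = G := by
  have gx := h.gx
  have gy := h.gy
  rw [h1] at gx
  rw [h2] at gy
  have mx : ∀ u, u ∈ X ↔ u ≠ [] ∧ ∃ w ∈ G, lo m w = u := by
    intro u; rw [← Finset.mem_val, h1, mem_Res]; rfl
  have my : ∀ u, u ∈ Y ↔ u ≠ [] ∧ ∃ w ∈ G, hi m w = u := by
    intro u; rw [← Finset.mem_val, h2, mem_Res]; rfl
  refine ⟨?_, ?_⟩
  · rw [mem_Mt]
    refine ⟨?_, ?_⟩
    · intro p hp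
      obtain ⟨w, hw, a1, a2, rfl⟩ := mem_recT.1 hp
      exact ⟨(mx _).2 ⟨a1, w, hw, rfl⟩, (my _).2 ⟨a2, w, hw, rfl⟩⟩
    · intro p hp q hq hpq
      obtain ⟨w, hw, a1, a2, rfl⟩ := mem_recT.1 hp
      obtain ⟨v, hv, b1, b2, rfl⟩ := mem_recT.1 hq
      rcases hpq with e | e
      · rw [Res_inj gx hw hv a1 e]
      · rw [Res_inj gy hw hv a2 e]
  · ext w
    simp only [glueSet, Finset.mem_union, Finset.mem_image, Finset.mem_filter]
    constructor
    · rintro ((⟨p, hp, rfl⟩ | ⟨hw, hn⟩) | ⟨hw, hn⟩)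
      · obtain ⟨w, hw, a1, a2, rfl⟩ := mem_recT.1 hp
        have := hs w hw
        rw [Spl] at this
        simp only [this]; exact hw
      · obtain ⟨hne, v, hv, rfl⟩ := (mx w).1 hw
        have hh : hi m v = [] := by
          by_contra hc
          exact hn _ (mem_recT.2 ⟨v, hv, hne, hc, rfl⟩) rfl
        have := hs v hv
        rw [Spl, hh, List.append_nil] at this
        rw [this]; exact hv
      · obtain ⟨hne, v, hv, rfl⟩ := (my w).1 hw
        have hh : lo m v = [] := by
          by_contra hc
          exact hn _ (mem_recT.2 ⟨v, hv, hc, hne, rfl⟩) rfl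
        have := hs v hv
        rw [Spl, hh, List.nil_append] at this
        rw [this]; exact hv
    · intro hw
      have hsw := hs w hw
      have hwne := (hG.1 w hw).1
      by_cases a1 : lo m w = []
      · right
        rw [Spl, a1, List.nil_append] at hsw
        refine ⟨(my w).2 ⟨hwne, w, hw, hsw⟩, ?_⟩
        intro p hp e
        obtain ⟨v, hv, b1, b2, rfl⟩ := mem_recT.1 hp
        have : v = w := Res_inj gy hv hw b2 (by rw [hsw]; exact e)
        subst this
        exact b1 a1
      · left
        by_cases a2 : hi m w = []
        · right
          rw [Spl, a2, List.append_nil] at hsw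
          refine ⟨(mx w).2 ⟨hwne, w, hw, hsw⟩, ?_⟩
          intro p hp e
          obtain ⟨v, hv, b1, b2, rfl⟩ := mem_recT.1 hp
          have : v = w := Res_inj gx hv hw b1 (by rw [hsw]; exact e)
          subst this
          exact b2 a2
        · left
          exact ⟨_, mem_recT.2 ⟨w, hw, a1, a2, rfl⟩, hsw⟩

end PFaux


namespace PFaux

theorem shift_mono (m : ℕ) (s : Set ℕ) : StrictMonoOn (fun x => x + m) s :=
  fun x _ y _ h => by simpa using h

theorem shiftF_val (m : ℕ) (d : W) : (shiftF m (LR d)).toFinset = (LR (shiftW m d)).toFinset := by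
  ext w
  rw [mem_FS, shiftW, MS_map (shift_mono m _)]
  simp [shiftF, MS, shiftW]

theorem Rset_eq (c d : W) :
    Rset c d = Mt (LR c).toFinset (LR (shiftW c.length d)).toFinset := by
  rw [Rset, shiftF_val, Mt]

theorem mTheta_eq (c d : W) (Θ : Finset (W × W)) : mTheta c d Θ =
    wordOfSet (glueSet (LR c).toFinset (LR (shiftW c.length d)).toFinset Θ) := by
  rw [mTheta, shiftF_val]

theorem LH_of {m : ℕ} {c d : W} (hc : ∀ x ∈ c, x ≤ m) (hd : ∀ x ∈ d, m < x) :
    LH m (LR c).toFinset (LR d).toFinset := by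
  refine ⟨?_, ?_, ?_, ?_⟩
  · rw [FS_val]; exact good_MS c
  · rw [FS_val]; exact good_MS d
  · intro u hu x hx
    exact hc x (mem_of_MS (mem_FS.1 hu) hx)
  · intro u hu x hx
    exact hd x (mem_of_MS (mem_FS.1 hu) hx)

theorem lt_of_mem_shift {b : W} (hb : IsPF b) (m : ℕ) : ∀ x ∈ shiftW m b, m < x := by
  intro x hx
  obtain ⟨y, hy, rfl⟩ := List.mem_map.1 hx
  have := hb.1 y hy
  omega

theorem MS_append {c d : W} {m : ℕ} (hc : ∀ x ∈ c, x ≤ m) (hd' : ∀ x ∈ d, m < x) :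
    MS (d ++ c) = MS c + MS d := by
  have h1 := segs_SD c
  have h2 := segs_SD d
  have : SD (segs d ++ segs c) := by
    refine ⟨?_, ?_⟩
    · intro w hw
      rcases List.mem_append.1 hw with hw | hw
      · exact h2.1 w hw
      · exact h1.1 w hw
    · rw [List.pairwise_append]
      refine ⟨h2.2, h1.2, ?_⟩
      intro u hu v hv
      have a1 := hd' _ (mem_of_MS (a := d) (w := u) (by rw [MS_eq]; simpa using hu)
        (hd_mem (h2.1 u hu)))
      have a2 := hc _ (mem_of_MS (a := c) (w := v) (by rw [MS_eq]; simpa using hv)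
        (hd_mem (h1.1 v hv)))
      omega
  have e := MS_of_SD this
  rw [List.flatten_append, segs_flatten, segs_flatten] at e
  rw [e, MS_eq, MS_eq, add_comm]
  simp

/-- product formula on upsets -/
theorem mul_sum {m : ℕ} {a b : W} (ha : ∀ x ∈ a, x ≤ m) (hb : ∀ x ∈ b, m < x)
    {M : Type*} [AddCommMonoid M] (f : W → M) :
    ∑ c ∈ U a, ∑ d ∈ U b, ∑ Θ ∈ Mt (LR c).toFinset (LR d).toFinset,
      f (wordOfSet (glueSet (LR c).toFinset (LR d).toFinset Θ)) = ∑ e ∈ U (b ++ a), f e := by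
  have lh : ∀ c ∈ U a, ∀ d ∈ U b, LH m (LR c).toFinset (LR d).toFinset := by
    intro c hc d hd
    exact LH_of (fun x hx => ha x ((U_perm hc).mem_iff.1 hx))
      (fun x hx => hb x ((U_perm hd).mem_iff.1 hx))
  have hr : ∀ c : W, ∑ d ∈ U b, ∑ Θ ∈ Mt (LR c).toFinset (LR d).toFinset,
      f (wordOfSet (glueSet (LR c).toFinset (LR d).toFinset Θ)) =
      ∑ x ∈ (U b).sigma (fun d => Mt (LR c).toFinset (LR d).toFinset),
        f (wordOfSet (glueSet (LR c).toFinset (LR x.1).toFinset x.2)) := by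
    intro c; rw [Finset.sum_sigma']
  simp only [hr]
  rw [Finset.sum_sigma']
  have spec : ∀ c ∈ U a, ∀ d ∈ U b, ∀ Θ ∈ Mt (LR c).toFinset (LR d).toFinset,
      (LR (wordOfSet (glueSet (LR c).toFinset (LR d).toFinset Θ))).toFinset =
        glueSet (LR c).toFinset (LR d).toFinset Θ := by
    intro c hc d hd Θ hΘ
    apply Finset.val_injective
    rw [FS_val, wordOfSet_spec _ (glue_good (lh c hc d hd) hΘ)]
  refine Finset.sum_nbij
    (fun x => wordOfSet (glueSet (LR x.1).toFinset (LR x.2.1).toFinset x.2.2)) ?_ ?_ ?_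
    (fun _ _ => rfl)
  · rintro ⟨c, d, Θ⟩ h
    simp only [Finset.mem_sigma] at h
    obtain ⟨hc, hd, hΘ⟩ := h
    have hl := lh c hc d hd
    rw [mem_U, wordOfSet_spec _ (glue_good hl hΘ), MS_append ha hb]
    have := (glue_val hl hΘ).2
    rw [FS_val, FS_val] at this
    exact Relation.ReflTransGen.trans (Le.add (mem_U.1 hc) (mem_U.1 hd)) this
  · rintro ⟨c, d, Θ⟩ h ⟨c', d', Θ'⟩ h' he
    simp only [Finset.coe_sigma, Set.mem_sigma_iff, Finset.mem_coe, Finset.mem_sigma] at h h'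
    obtain ⟨hc, hd, hΘ⟩ := h
    obtain ⟨hc', hd', hΘ'⟩ := h'
    have hl := lh c hc d hd
    have hl' := lh c' hc' d' hd'
    have hg : glueSet (LR c).toFinset (LR d).toFinset Θ =
        glueSet (LR c').toFinset (LR d').toFinset Θ' := by
      rw [← spec c hc d hd Θ hΘ, ← spec c' hc' d' hd' Θ' hΘ']
      simp only at he
      rw [he]
    have e1 : c = c' := by
      apply MS_inj
      rw [← FS_val, ← FS_val, ← glue_lo hl hΘ, ← glue_lo hl' hΘ', hg]
    have e2 : d = d' := by
      apply MS_inj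
      rw [← FS_val, ← FS_val, ← glue_hi hl hΘ, ← glue_hi hl' hΘ', hg]
    subst e1 e2
    have e3 : Θ = Θ' := by
      ext1 p
      rw [mem_Theta hl hΘ, mem_Theta hl' hΘ', hg]
    subst e3
    rfl
  · intro e he
    have he' := mem_U.1 he
    rw [MS_append ha hb] at he'
    have hs := he'.spl (m := m) (by
      intro w hw
      rcases Multiset.mem_add.1 hw with hw | hw
      · have : ∀ x ∈ w, x ≤ m := fun x hx => ha x (mem_of_MS hw hx)
        rw [Spl, lo_self this, hi_nil this, List.append_nil]
      · have : ∀ x ∈ w, m < x := fun x hx => hb x (mem_of_MS hw hx)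
        rw [Spl, lo_nil this, hi_self this, List.nil_append])
    have l1 : Le (MS a) (Res (lo m) (MS e)) := by
      have := he'.lo m
      rw [Res_add, Res_self, Res_zero, add_zero] at this
      · exact this
      · intro w hw; exact lo_nil fun x hx => hb x (mem_of_MS hw hx)
      · intro w hw
        exact ⟨lo_self fun x hx => ha x (mem_of_MS hw hx), ((good_MS a).1 w hw).1⟩
    have l2 : Le (MS b) (Res (hi m) (MS e)) := by
      have := he'.hi m
      rw [Res_add, Res_zero, Res_self, zero_add] at this
      · exact this
      · intro w hw
        exact ⟨hi_self fun x hx => hb x (mem_of_MS hw hx), ((good_MS b).1 w hw).1⟩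
      · intro w hw; exact hi_nil fun x hx => ha x (mem_of_MS hw hx)
    obtain ⟨c, ec⟩ := exists_word (l1.good (good_MS a))
    obtain ⟨d, ed⟩ := exists_word (l2.good (good_MS b))
    have hc : c ∈ U a := by rw [mem_U, ec]; exact l1
    have hd : d ∈ U b := by rw [mem_U, ed]; exact l2
    obtain ⟨r1, r2⟩ := rec_glue (lh c hc d hd) (G := (LR e).toFinset)
      (by rw [FS_val]; exact good_MS e) (fun w hw => hs w (mem_FS.1 hw))
      (by rw [FS_val, FS_val, ec]) (by rw [FS_val, FS_val, ed])
    refine ⟨⟨c, d, recT m (LR e).toFinset⟩, ?_, ?_⟩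
    · simp only [Finset.coe_sigma, Set.mem_sigma_iff, Finset.mem_coe, Finset.mem_sigma]
      exact ⟨hc, hd, r1⟩
    · simp only [r2, wordOfSet_FS]

theorem star_sum (K : Type) [Field K] (s t : Finset W) :
    starF K (∑ c ∈ s, Mb K c) (∑ d ∈ t, Mb K d) = ∑ c ∈ s, ∑ d ∈ t, mulSingle K c d := by
  rw [starF_eq, map_sum]
  refine Finset.sum_congr rfl fun c _ => ?_
  simp [Mb]

theorem star_Qb (K : Type) [Field K] {a b : W} (ha : IsPF a) (hb : IsPF b) :
    starF K (Qb K a) (Qb K b) = Qb K (slashProd a b) := by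
  have hs : IsPF (slashProd a b) := isPF_perm (slash_perm a b).symm (isPF_append ha hb)
  rw [Qb, Qb, Qb, filter_eq_U ha, filter_eq_U hb, filter_eq_U hs, star_sum, slashProd,
    ← mul_sum (m := a.length) (fun x hx => isPF_le ha hx) (lt_of_mem_shift hb a.length)]
  refine Finset.sum_congr rfl fun c hc => ?_
  have hl : c.length = a.length := (U_perm hc).length_eq
  rw [U_map b (shiftW a.length) (fun x => x + a.length) (shift_mono _ _) (fun _ _ => rfl)]
  refine Finset.sum_congr rfl fun d _ => ?_
  rw [mulSingle, Rset_eq, hl]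
  refine Finset.sum_congr rfl fun Θ _ => ?_
  rw [mTheta_eq, hl]

theorem Q_star (K : Type) [Field K] (x y : FW K)
    (hx : x ∈ spanQ K NonInc) (hy : y ∈ spanQ K NonInc) : starF K x y ∈ spanQ K NonInc := by
  refine star_closed K _ ?_ x y hx hy
  rintro _ ⟨a, ha, pa, rfl⟩ _ ⟨b, hb, pb, rfl⟩
  rw [star_Qb K ha hb]
  have := slash_C a b ha hb pa pb
  exact Submodule.subset_span ⟨_, this.1, this.2.1, rfl⟩

theorem mul_closed_of (P : W → Prop)
    (h : ∀ a b : W, IsPF a → IsPF b → P a → P b → ∀ e : W, ∀ Θ,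
      LH a.length (LR a).toFinset (LR (shiftW a.length b)).toFinset →
      Θ ∈ Mt (LR a).toFinset (LR (shiftW a.length b)).toFinset →
      MS e = (glueSet (LR a).toFinset (LR (shiftW a.length b)).toFinset Θ).val →
      IsPF e → e.Perm (a ++ shiftW a.length b) → P e) : MulClosed P := by
  intro a b ha hb pa pb Θ hΘ
  rw [Rset_eq] at hΘ
  rw [mTheta_eq]
  have hl : LH a.length (LR a).toFinset (LR (shiftW a.length b)).toFinset :=
    LH_of (fun x hx => isPF_le ha hx) (lt_of_mem_shift hb a.length)
  have e1 := wordOfSet_spec _ (glue_good hl hΘ)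
  set e := wordOfSet (glueSet (LR a).toFinset (LR (shiftW a.length b)).toFinset Θ) with he
  have hp : e.Perm (a ++ shiftW a.length b) := by
    have := (glue_val hl hΘ).2.lett_eq
    rw [← e1, FS_val, FS_val, lett_add, lett_MS, lett_MS, lett_MS] at this
    exact (Multiset.coe_eq_coe.1 this).symm
  have hpf := isPF_perm hp.symm (isPF_append ha hb)
  refine ⟨hpf, h a b ha hb pa pb e Θ hl hΘ e1 hpf hp, ?_⟩
  rw [hp.length_eq]; simp [shiftW]

theorem Nprop_iff (a : W) : Nprop a ↔ ∀ w ∈ MS a, w.Pairwise (· ≤ ·) := by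
  unfold Nprop
  refine forall_congr' fun w => ?_
  refine imp_congr Iff.rfl ?_
  change List.IsChain _ _ ↔ _
  exact List.isChain_iff_pairwise

theorem mul_N : MulClosed Nprop := by
  apply mul_closed_of
  intro a b ha hb pa pb e Θ hl hΘ he _ _
  have pb' : Nprop (shiftW a.length b) := by
    rw [Nprop_iff] at pb ⊢
    rw [shiftW, MS_map (shift_mono _ _)]
    intro w hw
    obtain ⟨u, hu, rfl⟩ := Multiset.mem_map.1 hw
    rw [List.pairwise_map]
    exact (pb u hu).imp (fun h => by omega)
  rw [Nprop_iff] at pa pb' ⊢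
  rw [he, (glue_val hl hΘ).1]
  rw [mem_Mt] at hΘ
  intro w hw
  rw [Multiset.mem_add, Multiset.mem_add, Multiset.mem_map] at hw
  rcases hw with (⟨p, hp, rfl⟩ | hw) | hw
  · obtain ⟨h1, h2⟩ := hΘ.1 p hp
    rw [List.pairwise_append]
    refine ⟨pa _ (mem_FS.1 h1), pb' _ (mem_FS.1 h2), ?_⟩
    intro x hx y hy
    exact (hl.lx _ h1 x hx).trans (hl.ly _ h2 y hy).le
  · exact pa w (mem_FS.1 (Finset.mem_filter.1 hw).1)
  · exact pb' w (mem_FS.1 (Finset.mem_filter.1 hw).1)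

theorem mul_D : MulClosed Dprop := by
  apply mul_closed_of
  intro a b ha hb pa pb e Θ hl hΘ he _ _
  have pb' : Dprop (shiftW a.length b) := by
    rw [Dprop_iff] at pb ⊢
    rw [shiftW, MS_map (shift_mono _ _)]
    intro u hu v hv huv x hx hx'
    obtain ⟨u, hu', rfl⟩ := Multiset.mem_map.1 hu
    obtain ⟨v, hv', rfl⟩ := Multiset.mem_map.1 hv
    obtain ⟨y, hy, rfl⟩ := List.mem_map.1 hx
    obtain ⟨z, hz, e⟩ := List.mem_map.1 hx'
    have : z = y := by simpa using e
    subst this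
    refine pb u hu' v hv' ?_ z hy hz
    rintro rfl; exact huv rfl
  rw [Dprop_iff] at pa pb' ⊢
  have h1 := glue_lo hl hΘ
  have h2 := glue_hi hl hΘ
  rw [← he, FS_val] at h1 h2
  intro u hu v hv huv x hx hx'
  by_cases hm : x ≤ a.length
  · have xu : x ∈ lo a.length u := mem_lo.2 ⟨hx, hm⟩
    have xv : x ∈ lo a.length v := mem_lo.2 ⟨hx', hm⟩
    have nu := List.ne_nil_of_mem xu
    have nv := List.ne_nil_of_mem xv
    refine pa (lo a.length u) ?_ (lo a.length v) ?_ ?_ x xu xv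
    · rw [← h1, mem_Res]; exact ⟨nu, u, hu, rfl⟩
    · rw [← h1, mem_Res]; exact ⟨nv, v, hv, rfl⟩
    · intro e'
      exact huv (Res_inj (by rw [h1]; exact good_MS _) hu hv nu e')
  · push Not at hm
    have xu : x ∈ hi a.length u := mem_hi.2 ⟨hx, hm⟩
    have xv : x ∈ hi a.length v := mem_hi.2 ⟨hx', hm⟩
    have nu := List.ne_nil_of_mem xu
    have nv := List.ne_nil_of_mem xv
    refine pb' (hi a.length u) ?_ (hi a.length v) ?_ ?_ x xu xv
    · rw [← h2, mem_Res]; exact ⟨nu, u, hu, rfl⟩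
    · rw [← h2, mem_Res]; exact ⟨nv, v, hv, rfl⟩
    · intro e'
      exact huv (Res_inj (by rw [h2]; exact good_MS _) hu hv nu e')

theorem mul_S : MulClosed Sprop := by
  apply mul_closed_of
  intro a b ha hb pa pb e Θ hl hΘ he hpf hp
  refine Sprop_of hpf (hp.nodup_iff.2 ?_)
  rw [List.nodup_append']
  refine ⟨Sprop_nodup pa, ?_, ?_⟩
  · refine List.Nodup.map ?_ (Sprop_nodup pb)
    intro x y h
    simpa using h
  · intro x hx hy
    have h1 := isPF_le ha hx
    have h2 := lt_of_mem_shift hb _ x hy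
    omega

end PFaux

/-- The families `N`, `D`, `S` are closed under `aΘb` and under
parkization of subwords; the family `C` is closed under the slash product and
under parkization of subwords.  Consequently the spans of
`{M_a : a ∈ ∪ₙ N_n}`, `{M_a : a ∈ ∪ₙ D_n}`, `{M_a : a ∈ ∪ₙ S_n}` and of
`{Q_a : a ∈ ∪ₙ C_n}` are closed under the product `⋆` and the coproduct `Δ`
of `PFSym`. -/
theorem stmt17 (K : Type) [Field K] [CharZero K] :
    (MulClosed Nprop ∧ ParkClosed Nprop) ∧
    (MulClosed Dprop ∧ ParkClosed Dprop) ∧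
    (MulClosed Sprop ∧ ParkClosed Sprop) ∧
    ((∀ a b : W, IsPF a → IsPF b → NonInc a → NonInc b →
        IsPF (slashProd a b) ∧ NonInc (slashProd a b) ∧
          (slashProd a b).length = a.length + b.length) ∧
      ParkClosed NonInc) ∧
    (∀ x y : FW K, x ∈ spanM K Nprop → y ∈ spanM K Nprop →
      starF K x y ∈ spanM K Nprop) ∧
    (∀ x : FW K, x ∈ spanM K Nprop → deltaF K x ∈ spanM2 K Nprop) ∧
    (∀ x y : FW K, x ∈ spanM K Dprop → y ∈ spanM K Dprop →
      starF K x y ∈ spanM K Dprop) ∧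
    (∀ x : FW K, x ∈ spanM K Dprop → deltaF K x ∈ spanM2 K Dprop) ∧
    (∀ x y : FW K, x ∈ spanM K Sprop → y ∈ spanM K Sprop →
      starF K x y ∈ spanM K Sprop) ∧
    (∀ x : FW K, x ∈ spanM K Sprop → deltaF K x ∈ spanM2 K Sprop) ∧
    (∀ x y : FW K, x ∈ spanQ K NonInc → y ∈ spanQ K NonInc →
      starF K x y ∈ spanQ K NonInc) ∧
    (∀ x : FW K, x ∈ spanQ K NonInc → deltaF K x ∈ spanQ2 K NonInc) := by
  exact ⟨⟨PFaux.mul_N, PFaux.park_N⟩, ⟨PFaux.mul_D, PFaux.park_D⟩, ⟨PFaux.mul_S, PFaux.park_S⟩,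
    ⟨PFaux.slash_C, PFaux.park_C⟩,
    PFaux.M_star K _ PFaux.mul_N, PFaux.M_delta K _ PFaux.park_N,
    PFaux.M_star K _ PFaux.mul_D, PFaux.M_delta K _ PFaux.park_D,
    PFaux.M_star K _ PFaux.mul_S, PFaux.M_delta K _ PFaux.park_S,
    PFaux.Q_star K, PFaux.Q_delta K _ PFaux.park_C⟩
end
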